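/- arXiv:math/0508546 — 7 statements merged into one kernel-verified Lean document; each statement's English description precedes it below -/
import Mathlib

section
/- Let p ≠ 5 be an odd prime. Then F_{p+1}(q) ≡ (1 + (5/p))/2 (mod [p]_q) in ℤ[q], where (5/p) is the Legendre symbol; i.e., F_{p+1}(q) ≡ 1 (mod [p]_q) if p ≡ ±1 (mod 5) and F_{p+1}(q) ≡ 0 (mod [p]_q) if p ≡ ±2 (mod 5). -/
open Polynomial

/-- The Schur q-Fibonacci polynomials: F₀ = 0, F₁ = 1, Fₙ = Fₙ₋₁ + q^(n-2) Fₙ₋₂. -/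
noncomputable def qF : ℕ → Polynomial ℤ
  | 0 => 0
  | 1 => 1
  | n + 2 => qF (n + 1) + X ^ n * qF n
/-- [n]_q = 1 + q + ⋯ + q^(n-1) in ℤ[q]. -/
noncomputable def qbracket (n : ℕ) : Polynomial ℤ := ∑ i ∈ Finset.range n, X ^ i

section aux
variable {K : Type*} [Field K]

/-- Gaussian binomials evaluated at `q`, with integer lower index. -/
noncomputable def gb (q : K) : ℕ → ℤ → K
  | 0, k => if k = 0 then 1 else 0
  | n + 1, k => gb q n (k - 1) + q ^ k * gb q n k

theorem gb_p1 (q : K) (n : ℕ) (k k' : ℤ) (h : k' = k - 1) :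
    gb q (n + 1) k = gb q n k' + q ^ k * gb q n k := by
  subst h; rfl

theorem gb_p2 (q : K) (hq : q ≠ 0) (n : ℕ) : ∀ (k k' e : ℤ), k' = k - 1 → e = n + 1 - k →
    gb q (n + 1) k = gb q n k + q ^ e * gb q n k' := by
  induction n with
  | zero =>
    rintro k _ _ rfl rfl
    simp only [gb]
    by_cases h0 : k = 0
    · subst h0; simp
    · by_cases h1 : k = 1
      · subst h1; simp
      · have : k - 1 ≠ 0 := by omega
        simp [h0, this]
  | succ n ih =>
    rintro k _ _ rfl rfl
    rw [gb_p1 q (n + 1) k (k - 1) rfl]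
    have h2 := ih k (k - 1) (n + 1 - k) (by ring) (by ring)
    have h3 := gb_p1 q n k (k - 1) rfl
    have h4 := gb_p1 q n (k - 1) (k - 2) (by ring)
    have h5 := ih (k - 1) (k - 2) (n + 2 - k) (by ring) (by ring)
    have e1 : q ^ k * q ^ ((n : ℤ) + 1 - k) = q ^ ((n : ℤ) + 2 - k) * q ^ (k - 1) := by
      rw [← zpow_add₀ hq, ← zpow_add₀ hq]; congr 1; ring
    have e0 : (((n + 1 : ℕ) : ℤ) + 1 - k) = (n : ℤ) + 2 - k := by push_cast; ring
    rw [e0]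
    linear_combination h5 + q ^ k * h2 - h3 - q ^ ((n : ℤ) + 2 - k) * h4 + e1 * gb q n (k - 1)

theorem gb_neg (q : K) (n : ℕ) : ∀ k : ℤ, k < 0 → gb q n k = 0 := by
  induction n with
  | zero => intro k hk; simp [gb, hk.ne]
  | succ n ih => intro k hk; simp [gb, ih k hk, ih (k - 1) (by omega)]

theorem gb_big (q : K) (n : ℕ) : ∀ k : ℤ, (n : ℤ) < k → gb q n k = 0 := by
  induction n with
  | zero => intro k hk; have : k ≠ 0 := by simp at hk; omega
            simp [gb, this]
  | succ n ih =>
    intro k hk; push_cast at hk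
    simp [gb, ih k (by omega), ih (k - 1) (by omega)]

theorem gb_zero (q : K) (n : ℕ) : gb q n 0 = 1 := by
  induction n with
  | zero => simp [gb]
  | succ n ih => simp [gb, ih, gb_neg]

theorem gb_self (q : K) (n : ℕ) : gb q n n = 1 := by
  induction n with
  | zero => simp [gb]
  | succ n ih => simp [gb, ih, gb_big]

theorem gb_prim (q : K) (p : ℕ) (hp : 0 < p) (h : IsPrimitiveRoot q p) (k : ℕ) (hk : k + 1 < p) :
    gb q p ((k : ℤ) + 1) = 0 := by
  have hq : q ≠ 0 := h.ne_zero hp.ne'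
  have key : ∀ k : ℕ, gb q p (k : ℤ) * (1 - q ^ ((p : ℤ) - k)) =
      gb q p ((k : ℤ) + 1) * (1 - q ^ ((k : ℤ) + 1)) := by
    intro k
    have a := gb_p1 q p (k + 1) k (by ring)
    have b := gb_p2 q hq p (k + 1) k (p - k) (by ring) (by ring)
    linear_combination b - a
  have ne : ∀ k : ℕ, k + 1 < p → (1 - q ^ ((k : ℤ) + 1)) ≠ 0 := by
    intro k hk h0
    have h1 : q ^ (k + 1) = 1 := by
      have : q ^ ((k : ℤ) + 1) = q ^ (k + 1) := by exact_mod_cast zpow_natCast q (k + 1)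
      rw [← this]; linear_combination -h0
    exact h.pow_ne_one_of_pos_of_lt (by omega) hk h1
  induction k with
  | zero =>
    have := key 0
    have hpp : q ^ (p : ℤ) = 1 := by rw [zpow_natCast]; exact h.pow_eq_one
    simp only [Nat.cast_zero, sub_zero, hpp, sub_self, mul_zero] at this
    have n0 := ne 0 hk
    simp only [Nat.cast_zero] at n0 ⊢
    exact (mul_eq_zero.mp this.symm).resolve_right n0
  | succ k ih =>
    have := key (k + 1)
    push_cast at this ⊢
    rw [ih (by omega), zero_mul] at this
    have n0 := ne (k + 1) hk
    push_cast at n0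
    exact (mul_eq_zero.mp this.symm).resolve_right n0

theorem gb_prim' (q : K) (p : ℕ) (hp : 0 < p) (h : IsPrimitiveRoot q p) (k : ℤ) :
    gb q p k = if k = 0 ∨ k = p then 1 else 0 := by
  split_ifs with hk
  · rcases hk with rfl | rfl
    · exact gb_zero q p
    · exact gb_self q p
  · push Not at hk
    rcases lt_trichotomy k 0 with h0 | h0 | h0
    · exact gb_neg q p k h0
    · exact absurd h0 hk.1
    · rcases lt_trichotomy k p with h1 | h1 | h1
      · obtain ⟨j, rfl⟩ : ∃ j : ℕ, k = (j : ℤ) + 1 := ⟨(k - 1).toNat, by omega⟩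
        exact gb_prim q p hp h j (by omega)
      · exact absurd h1 hk.2
      · exact gb_big q p k h1

noncomputable def Et (q : K) (m : ℕ) (i : ℤ) : K :=
  q ^ (10 * i ^ 2 + i) * gb q (2 * m) (m - 5 * i)
    - q ^ (10 * i ^ 2 + 11 * i + 3) * gb q (2 * m) (m - 5 * i - 3)

noncomputable def Ot (q : K) (m : ℕ) (i : ℤ) : K :=
  q ^ (10 * i ^ 2 + i) * gb q (2 * m + 1) (m - 5 * i)
    - q ^ (10 * i ^ 2 + 11 * i + 3) * gb q (2 * m + 1) (m - 5 * i - 2)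

noncomputable def Tt (q : K) (m : ℕ) (i : ℤ) : K :=
  q ^ (10 * i ^ 2 - 4 * i + m + 1) * gb q (2 * m) (m + 1 - 5 * i)

theorem Ot_rec (q : K) (hq : q ≠ 0) (m : ℕ) (i : ℤ) :
    Ot q (m + 1) i = Et q (m + 1) i + q ^ (2 * m + 2) * Ot q m i := by
  unfold Ot Et
  have n1 : 2 * (m + 1) = 2 * m + 1 + 1 := by ring
  rw [n1]
  push_cast
  rw [gb_p2 q hq (2 * m + 1 + 1) (m + 1 - 5 * i) (m - 5 * i) (m + 2 + 5 * i) (by ring)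
      (by push_cast; ring),
    gb_p1 q (2 * m + 1 + 1) (m + 1 - 5 * i - 2) (m + 1 - 5 * i - 3) (by ring)]
  have g1 := gb_p1 q (2 * m + 1) (m - 5 * i) (m - 5 * i - 1) (by ring)
  have g2 := gb_p2 q hq (2 * m + 1) (m + 1 - 5 * i - 2) (m - 5 * i - 2) (m + 5 * i + 3) (by ring)
      (by push_cast; ring)
  have i1 : (m : ℤ) + 1 - 5 * i - 2 = m - 5 * i - 1 := by ring
  rw [i1] at g2 ⊢
  rw [g1, g2]
  have e1 : q ^ (10 * i ^ 2 + i) * q ^ ((m : ℤ) + 2 + 5 * i) = q ^ (10 * i ^ 2 + 6 * i + m + 2) := by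
    rw [← zpow_add₀ hq]; congr 1; ring
  have e2 : q ^ (10 * i ^ 2 + 6 * i + m + 2) * q ^ ((m : ℤ) - 5 * i)
      = q ^ (2 * m + 2) * q ^ (10 * i ^ 2 + i) := by
    rw [← zpow_natCast q (2 * m + 2), ← zpow_add₀ hq, ← zpow_add₀ hq]; congr 1; push_cast; ring
  have e3 : q ^ (10 * i ^ 2 + 11 * i + 3) * q ^ ((m : ℤ) - 5 * i - 1)
      = q ^ (10 * i ^ 2 + 6 * i + m + 2) := by
    rw [← zpow_add₀ hq]; congr 1; ring
  have e4 : q ^ (10 * i ^ 2 + 6 * i + m + 2) * q ^ ((m : ℤ) + 5 * i + 3)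
      = q ^ (2 * m + 2) * q ^ (10 * i ^ 2 + 11 * i + 3) := by
    rw [← zpow_natCast q (2 * m + 2), ← zpow_add₀ hq, ← zpow_add₀ hq]; congr 1; push_cast; ring
  generalize gb q (2 * m + 1) (m - 5 * i - 1) = x1 at *
  generalize gb q (2 * m + 1) (m - 5 * i) = x2 at *
  generalize gb q (2 * m + 1) (m - 5 * i - 2) = x3 at *
  linear_combination e1 * (x1 + q ^ ((m : ℤ) - 5 * i) * x2) + e2 * x2
    - e3 * (x1 + q ^ ((m : ℤ) + 5 * i + 3) * x3) - e4 * x3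

theorem Et_rec (q : K) (hq : q ≠ 0) (m : ℕ) (i : ℤ) :
    Et q (m + 1) i = Ot q m i + q ^ (2 * m + 1) * Et q m i + (Tt q m i - Tt q m (i + 1)) := by
  unfold Ot Et Tt
  have n1 : 2 * (m + 1) = 2 * m + 1 + 1 := by ring
  rw [n1]
  push_cast
  have i1 : (m : ℤ) + 1 - 5 * i - 3 = m - 5 * i - 2 := by ring
  have i2 : (m : ℤ) + 1 - 5 * (i + 1) = m - 5 * i - 4 := by ring
  rw [i1, i2]
  rw [gb_p1 q (2 * m + 1) (m + 1 - 5 * i) (m - 5 * i) (by ring),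
    gb_p2 q hq (2 * m + 1) (m - 5 * i - 2) (m - 5 * i - 3) (m + 5 * i + 4) (by ring)
      (by push_cast; ring),
    gb_p2 q hq (2 * m) (m + 1 - 5 * i) (m - 5 * i) (m + 5 * i) (by ring)
      (by push_cast; ring),
    gb_p1 q (2 * m) (m - 5 * i - 3) (m - 5 * i - 4) (by ring)]
  have e1 : q ^ (10 * i ^ 2 + i) * q ^ ((m : ℤ) + 1 - 5 * i) = q ^ (10 * i ^ 2 - 4 * i + m + 1) := by
    rw [← zpow_add₀ hq]; congr 1; ring
  have e2 : q ^ (10 * i ^ 2 - 4 * i + m + 1) * q ^ ((m : ℤ) + 5 * i)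
      = q ^ (2 * m + 1) * q ^ (10 * i ^ 2 + i) := by
    rw [← zpow_natCast q (2 * m + 1), ← zpow_add₀ hq, ← zpow_add₀ hq]; congr 1; push_cast; ring
  have e3 : q ^ (10 * i ^ 2 + 11 * i + 3) * q ^ ((m : ℤ) + 5 * i + 4)
      = q ^ (10 * (i + 1) ^ 2 - 4 * (i + 1) + m + 1) := by
    rw [← zpow_add₀ hq]; congr 1; ring
  have e4 : q ^ (10 * (i + 1) ^ 2 - 4 * (i + 1) + m + 1) * q ^ ((m : ℤ) - 5 * i - 3)
      = q ^ (2 * m + 1) * q ^ (10 * i ^ 2 + 11 * i + 3) := by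
    rw [← zpow_natCast q (2 * m + 1), ← zpow_add₀ hq, ← zpow_add₀ hq]; congr 1; push_cast; ring
  generalize gb q (2 * m) (m + 1 - 5 * i) = x1 at *
  generalize gb q (2 * m) (m - 5 * i) = x2 at *
  generalize gb q (2 * m) (m - 5 * i - 4) = x3 at *
  generalize gb q (2 * m) (m - 5 * i - 3) = x4 at *
  linear_combination e1 * (x1 + q ^ ((m : ℤ) + 5 * i) * x2) + e2 * x2
    - e3 * (x3 + q ^ ((m : ℤ) - 5 * i - 3) * x4) - e4 * x4

theorem schur (q : K) (hq : q ≠ 0) (N : ℕ) (m : ℕ) (hm : m ≤ N) :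
    (qF (2 * m + 1)).eval₂ (Int.castRingHom K) q
        = ∑ r ∈ Finset.range (2 * N + 1), Et q m ((r : ℤ) - N) ∧
    (qF (2 * m + 2)).eval₂ (Int.castRingHom K) q
        = ∑ r ∈ Finset.range (2 * N + 1), Ot q m ((r : ℤ) - N) := by
  induction m with
  | zero =>
    constructor
    · rw [Finset.sum_eq_single_of_mem N (by simp; omega)]
      · simp [qF, Et, gb]
      · intro r _ hr
        have h1 : (5 : ℤ) * (r - N) ≠ 0 := by omega
        have h2 : -((5 : ℤ) * (r - N)) - 3 ≠ 0 := by omega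
        simp only [Et, gb, Nat.cast_zero, zero_sub, neg_eq_zero, if_neg h1, if_neg h2, mul_zero,
          sub_self]
    · rw [Finset.sum_eq_single_of_mem N (by simp; omega)]
      · simp [qF, Ot, gb]
      · intro r _ hr
        have h1 : (5 : ℤ) * (r - N) ≠ 0 := by omega
        have h2 : -((5 : ℤ) * (r - N)) - 2 ≠ 0 := by omega
        have h3 : -((5 : ℤ) * (r - N)) - 1 ≠ 0 := by omega
        have h4 : -((5 : ℤ) * (r - N)) - 2 - 1 ≠ 0 := by omega
        simp only [Ot, gb, Nat.cast_zero, zero_sub, neg_eq_zero, if_neg h1, if_neg h2, if_neg h3,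
          if_neg h4, mul_zero, sub_self, add_zero]
  | succ m ih =>
    obtain ⟨hE, hO⟩ := ih (by omega)
    have hE' : (qF (2 * (m + 1) + 1)).eval₂ (Int.castRingHom K) q
        = ∑ r ∈ Finset.range (2 * N + 1), Et q (m + 1) ((r : ℤ) - N) := by
      have : qF (2 * (m + 1) + 1) = qF (2 * m + 2) + X ^ (2 * m + 1) * qF (2 * m + 1) := by
        rw [show 2 * (m + 1) + 1 = (2 * m + 1) + 2 by ring, qF]
      rw [this]
      simp only [eval₂_add, eval₂_mul, eval₂_X_pow, hE, hO, Et_rec q hq m, Finset.sum_add_distrib,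
        Finset.mul_sum]
      have tel := Finset.sum_range_sub' (fun r : ℕ => Tt q m ((r : ℤ) - N)) (2 * N + 1)
      have z1 : Tt q m (((0 : ℕ) : ℤ) - N) = 0 := by
        unfold Tt; rw [gb_big, mul_zero]; push_cast; omega
      have z2 : Tt q m (((2 * N + 1 : ℕ) : ℤ) - N) = 0 := by
        unfold Tt; rw [gb_neg, mul_zero]; push_cast; omega
      rw [z1, z2, sub_zero] at tel
      have : ∑ r ∈ Finset.range (2 * N + 1), (Tt q m ((r : ℤ) - N) - Tt q m ((r : ℤ) - N + 1)) = 0 := by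
        rw [← tel]
        refine Finset.sum_congr rfl fun r _ => ?_
        congr 2; push_cast; ring
      rw [this, add_zero]
    refine ⟨hE', ?_⟩
    have : qF (2 * (m + 1) + 2) = qF (2 * (m + 1) + 1) + X ^ (2 * m + 2) * qF (2 * m + 2) := by
      rw [show 2 * (m + 1) + 2 = (2 * m + 2) + 2 by ring, qF, show 2 * m + 2 + 1 = 2 * (m + 1) + 1 by ring]
    rw [this]
    simp only [eval₂_add, eval₂_mul, eval₂_X_pow, hE', hO, Ot_rec q hq m, Finset.sum_add_distrib,
        Finset.mul_sum]

theorem Ot_val (q : K) (p m : ℕ) (hpm : p = 2 * m + 1) (h : IsPrimitiveRoot q p)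
    (h5 : ¬ 5 ∣ p) (i : ℤ) :
    Ot q m i = if (p : ℤ) = 10 * i + 1 ∨ (p : ℤ) = -10 * i - 1 then 1 else 0 := by
  have hp : 0 < p := by omega
  have hpp : q ^ (p : ℤ) = 1 := by rw [zpow_natCast]; exact h.pow_eq_one
  unfold Ot
  rw [← hpm, gb_prim' q p hp h, gb_prim' q p hp h, if_neg (by omega : ¬ ((m : ℤ) - 5 * i - 2 = 0 ∨ _)),
    mul_zero, sub_zero]
  split_ifs with h1 h2 h2
  · rw [mul_one]
    rcases h2 with h2 | h2
    · rw [show 10 * i ^ 2 + i = p * i by rw [h2]; ring, zpow_mul, hpp, one_zpow]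
    · rw [show 10 * i ^ 2 + i = p * (-i) by rw [h2]; ring, zpow_mul, hpp, one_zpow]
  · omega
  · omega
  · rw [mul_zero]

end aux

instance fact5 : Fact (Nat.Prime 5) := ⟨by norm_num⟩

theorem leg5 (p : ℕ) [Fact p.Prime] (hodd : Odd p) (hp5 : p ≠ 5) :
    legendreSym p 5 = if p % 5 = 1 ∨ p % 5 = 4 then 1 else -1 := by
  have hp : p.Prime := Fact.out
  have hp2 : p ≠ 2 := by rintro rfl; revert hodd; decide
  have h := legendreSym.quadratic_reciprocity_one_mod_four (p := 5) (q := p) (by norm_num) hp2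
  have h' : legendreSym p 5 = legendreSym 5 p := by exact_mod_cast h
  rw [h', legendreSym.mod]
  have h5 : ¬ 5 ∣ p := fun hd => hp5 ((Nat.prime_dvd_prime_iff_eq (by norm_num) hp).mp hd).symm
  have h0 : p % 5 = 1 ∨ p % 5 = 2 ∨ p % 5 = 3 ∨ p % 5 = 4 := by omega
  have hc : ((p : ℤ) % (5 : ℕ)) = ((p % 5 : ℕ) : ℤ) := by push_cast; rfl
  rw [hc]
  rcases h0 with h0 | h0 | h0 | h0 <;> rw [h0] <;> decide

/-- For an odd prime p ≠ 5, F_{p+1}(q) ≡ (1 + (5/p))/2 (mod [p]_q) in ℤ[q]. -/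
theorem qFib_succ_prime_congr (p : ℕ) (hp : p.Prime) (hodd : Odd p) (hp5 : p ≠ 5) :
    qbracket p ∣ qF (p + 1) - C ((1 + @legendreSym p ⟨hp⟩ 5) / 2) := by
  have : Fact p.Prime := ⟨hp⟩
  have hz := Complex.isPrimitiveRoot_exp p hp.ne_zero
  set z := Complex.exp (2 * Real.pi * Complex.I / p) with hzdef
  have hq : z ≠ 0 := hz.ne_zero hp.ne_zero
  have h5 : ¬ 5 ∣ p := fun hd => hp5 ((Nat.prime_dvd_prime_iff_eq (by norm_num) hp).mp hd).symm
  rw [qbracket, ← cyclotomic_prime ℤ p, cyclotomic_eq_minpoly hz hp.pos]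
  refine minpoly.isIntegrallyClosed_dvd (hz.isIntegral hp.pos) ?_
  obtain ⟨m, hm⟩ := hodd
  have hs := (schur z hq p m (by omega)).2
  rw [show 2 * m + 2 = p + 1 by omega] at hs
  simp only [Ot_val z p m hm hz h5] at hs
  rw [aeval_def, eval₂_sub, eval₂_C]
  change eval₂ (Int.castRingHom ℂ) z _ - _ = 0
  rw [hs, leg5 p ⟨m, hm⟩ hp5]
  split_ifs with hc
  · have : ∃ r : ℕ, r < 2 * p + 1 ∧
      ((p : ℤ) = 10 * ((r : ℤ) - p) + 1 ∨ (p : ℤ) = -10 * ((r : ℤ) - p) - 1) := by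
      rcases hc with hc | hc
      · exact ⟨p + p / 10, by omega, by omega⟩
      · exact ⟨p - (p + 1) / 10, by omega, by omega⟩
    obtain ⟨r, hr, hr'⟩ := this
    rw [Finset.sum_eq_single_of_mem r (by simpa using hr), if_pos hr']
    · simp
    · intro s _ hs
      rw [if_neg]; omega
  · rw [Finset.sum_eq_zero]
    · simp
    · intro s _
      rw [if_neg]; omega
end

section
/- Let p ≠ 5 be an odd prime. Then F̂_{p−1}(q) ≡ (1 − (5/p))/2 (mod [p]_q) in ℤ[q], where (5/p) is the Legendre symbol; i.e., F̂_{p−1}(q) ≡ 0 (mod [p]_q) if p ≡ ±1 (mod 5) and F̂_{p−1}(q) ≡ 1 (mod [p]_q) if p ≡ ±2 (mod 5). -/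
open Polynomial

/-- The q-Fibonacci polynomials: F̂₀ = 0, F̂₁ = 1, F̂ₙ = F̂ₙ₋₁ + q^(n-1) F̂ₙ₋₂. -/
noncomputable def qFhat : ℕ → Polynomial ℤ
  | 0 => 0
  | 1 => 1
  | n + 2 => qFhat (n + 1) + X ^ (n + 1) * qFhat n
namespace QFibAux

/-- Gaussian binomials with integer lower index at a fixed complex parameter. -/
noncomputable def B (q : ℂ) : ℕ → ℤ → ℂ
  | 0, k => if k = 0 then 1 else 0
  | n + 1, k => B q n (k - 1) + q ^ k * B q n k

theorem B_eq (q : ℂ) (n : ℕ) (k k' : ℤ) (h : k' = k - 1) :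
    B q (n + 1) k = B q n k' + q ^ k * B q n k := by
  subst h; rfl

theorem B_neg (q : ℂ) (n : ℕ) : ∀ k : ℤ, k < 0 → B q n k = 0 := by
  induction n with
  | zero => intro k hk; simp [B, hk.ne]
  | succ n ih => intro k hk; simp [B, ih k hk, ih (k - 1) (by omega)]

theorem B_gt (q : ℂ) (n : ℕ) : ∀ k : ℤ, (n : ℤ) < k → B q n k = 0 := by
  induction n with
  | zero => intro k hk; simp at hk; simp [B, hk.ne']
  | succ n ih =>
    intro k hk; push_cast at hk
    simp [B, ih k (by omega), ih (k - 1) (by omega)]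

theorem B_zero (q : ℂ) (n : ℕ) : B q n 0 = 1 := by
  induction n with
  | zero => simp [B]
  | succ n ih => simp [B, ih, B_neg q n (-1) (by omega)]

theorem B_self (q : ℂ) (n : ℕ) : B q n n = 1 := by
  induction n with
  | zero => simp [B]
  | succ n ih =>
    simp [B, ih, B_gt q n ((n : ℤ) + 1) (by omega)]

theorem zmul {q : ℂ} (hq : q ≠ 0) {a b c : ℤ} (h : a + b = c) : q ^ a * q ^ b = q ^ c := by
  rw [← zpow_add₀ hq, h]

theorem B_pascal2 {q : ℂ} (hq : q ≠ 0) (n : ℕ) : ∀ k : ℤ,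
    B q (n + 1) k = q ^ ((n : ℤ) + 1 - k) * B q n (k - 1) + B q n k := by
  induction n with
  | zero =>
    intro k
    by_cases h0 : k = 0
    · subst h0; simp [B]
    · by_cases h1 : k = 1
      · subst h1; simp [B]
      · simp [B, h0, sub_eq_zero, h1]
  | succ n ih =>
    intro k
    rw [B_eq q (n + 1) k (k - 1) rfl]
    have e1 := ih (k - 1)
    have e2 := ih k
    have e3 := B_eq q n k (k - 1) rfl
    have e4 := B_eq q n (k - 1) (k - 1 - 1) rfl
    have h1 := zmul hq (a := k) (b := (n : ℤ) + 1 - k) (c := n + 1) (by ring)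
    have h2 := zmul hq (a := ((n + 1 : ℕ) : ℤ) + 1 - k) (b := k - 1) (c := n + 1)
      (by push_cast; ring)
    have h3 : (n : ℤ) + 1 - (k - 1) = ((n + 1 : ℕ) : ℤ) + 1 - k := by push_cast; ring
    rw [h3] at e1
    linear_combination e1 + q ^ k * e2 - q ^ (((n + 1 : ℕ) : ℤ) + 1 - k) * e4 - e3
      + B q n (k - 1) * h1 - B q n (k - 1) * h2

theorem B_eq2 {q : ℂ} (hq : q ≠ 0) (n : ℕ) (k k' e : ℤ) (h : k' = k - 1)
    (he : e = (n : ℤ) + 1 - k) :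
    B q (n + 1) k = q ^ e * B q n k' + B q n k := by
  subst h; subst he; exact B_pascal2 hq n k

theorem B_mul {q : ℂ} (hq : q ≠ 0) (n : ℕ) (k : ℤ) :
    (1 - q ^ k) * B q (n + 1) k = (1 - q ^ (n + 1)) * B q n (k - 1) := by
  have e1 := B_eq q n k (k - 1) rfl
  have e2 := B_pascal2 hq n k
  have h1 := zmul hq (a := k) (b := (n : ℤ) + 1 - k) (c := ((n + 1 : ℕ) : ℤ))
    (by push_cast; ring)
  rw [zpow_natCast] at h1
  linear_combination e1 - q ^ k * e2 - B q n (k - 1) * h1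

theorem B_prime {q : ℂ} {p : ℕ} (hp : p ≠ 0) (hq : IsPrimitiveRoot q p) (k : ℤ)
    (h0 : k ≠ 0) (h1 : k ≠ p) : B q p k = 0 := by
  rcases lt_or_ge k 0 with h | h
  · exact B_neg q p k h
  rcases lt_or_ge (p : ℤ) k with h' | h'
  · exact B_gt q p k h'
  obtain ⟨n, rfl⟩ := Nat.exists_eq_succ_of_ne_zero hp
  have hm := B_mul (hq.ne_zero hp) n k
  have hq1 := hq.pow_eq_one
  rw [Nat.succ_eq_add_one] at hq1
  rw [hq1, sub_self, zero_mul] at hm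
  rcases mul_eq_zero.1 hm with h2 | h2
  · exfalso
    have h3 : q ^ k = 1 := by linear_combination -h2
    rw [hq.zpow_eq_one_iff_dvd] at h3
    have := Int.le_of_dvd (by omega) h3
    omega
  · exact h2

/-- term, even index `2m` -/
noncomputable def cE (q : ℂ) (m : ℕ) (i : ℤ) : ℂ :=
  q ^ (10 * i ^ 2 - 3 * i) * B q (2 * m) (m + 1 - 5 * i)
    - q ^ (10 * i ^ 2 + 7 * i + 1) * B q (2 * m) (m - 2 - 5 * i)

/-- term, odd index `2m+1` -/
noncomputable def cO (q : ℂ) (m : ℕ) (i : ℤ) : ℂ :=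
  q ^ (10 * i ^ 2 - 3 * i) * B q (2 * m + 1) (m + 1 - 5 * i)
    - q ^ (10 * i ^ 2 + 7 * i + 1) * B q (2 * m + 1) (m - 1 - 5 * i)

/-- difference term -/
noncomputable def d (q : ℂ) (m : ℕ) (i : ℤ) : ℂ :=
  q ^ (10 * i ^ 2 - 8 * i + m + 2) * B q (2 * m + 1) (m + 2 - 5 * i)
    - q ^ (10 * i ^ 2 + 12 * i + m + 4) * B q (2 * m + 1) (m - 2 - 5 * i)

/-- telescoping term -/
noncomputable def f (q : ℂ) (m : ℕ) (i : ℤ) : ℂ :=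
  q ^ (10 * i ^ 2 - 8 * i + m + 2) * B q (2 * m) (m + 2 - 5 * i)

theorem cE_sub {q : ℂ} (hq : q ≠ 0) (m : ℕ) (i : ℤ) :
    cE q (m + 1) i - cO q m i = d q m i := by
  unfold cE cO d
  have e1 := B_eq q (2 * m + 1) ((m + 1 : ℕ) + 1 - 5 * i) (m + 1 - 5 * i) (by push_cast; ring)
  have e2 := B_eq2 hq (2 * m + 1) ((m + 1 : ℕ) - 2 - 5 * i) (m - 2 - 5 * i) (m + 3 + 5 * i)
    (by push_cast; ring) (by push_cast; ring)
  have h1 := zmul hq (a := 10 * i ^ 2 - 3 * i) (b := (m + 1 : ℕ) + 1 - 5 * i)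
    (c := 10 * i ^ 2 - 8 * i + m + 2) (by push_cast; ring)
  have h2 := zmul hq (a := 10 * i ^ 2 + 7 * i + 1) (b := m + 3 + 5 * i)
    (c := 10 * i ^ 2 + 12 * i + m + 4) (by ring)
  have k1 : ((m + 1 : ℕ) : ℤ) + 1 - 5 * i = m + 2 - 5 * i := by push_cast; ring
  have k2 : ((m + 1 : ℕ) : ℤ) - 2 - 5 * i = m - 1 - 5 * i := by push_cast; ring
  rw [k1] at e1 h1 ⊢
  rw [k2] at e2 ⊢
  rw [show 2 * (m + 1) = 2 * m + 1 + 1 by ring, e1, e2, ← h1, ← h2]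
  ring

theorem d_eq {q : ℂ} (hq : q ≠ 0) (m : ℕ) (i : ℤ) :
    d q m i = q ^ (2 * m + 1) * cE q m i + (f q m i - f q m (i + 1)) := by
  unfold cE d f
  have e1 := B_eq2 hq (2 * m) (m + 2 - 5 * i) (m + 1 - 5 * i) (m - 1 + 5 * i)
    (by ring) (by push_cast; ring)
  have e2 := B_eq q (2 * m) (m - 2 - 5 * i) (m - 3 - 5 * i) (by ring)
  have h1 := zmul hq (a := 10 * i ^ 2 - 8 * i + m + 2) (b := m - 1 + 5 * i)
    (c := (2 * m + 1 : ℕ) + (10 * i ^ 2 - 3 * i)) (by push_cast; ring)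
  have h2 := zmul hq (a := 10 * i ^ 2 + 12 * i + m + 4) (b := m - 2 - 5 * i)
    (c := (2 * m + 1 : ℕ) + (10 * i ^ 2 + 7 * i + 1)) (by push_cast; ring)
  rw [zpow_add₀ hq ((2 * m + 1 : ℕ) : ℤ), zpow_natCast] at h1 h2
  have k1 : (m : ℤ) + 2 - 5 * (i + 1) = m - 3 - 5 * i := by ring
  have k2 : 10 * (i + 1) ^ 2 - 8 * (i + 1) + m + 2 = 10 * i ^ 2 + 12 * i + m + 4 := by ring
  rw [k1, k2, e1, e2]
  linear_combination B q (2 * m) (m + 1 - 5 * i) * h1 - B q (2 * m) (m - 2 - 5 * i) * h2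

theorem cO_eq {q : ℂ} (hq : q ≠ 0) (m : ℕ) (i : ℤ) :
    cO q (m + 1) i = cE q (m + 1) i + q ^ (2 * m + 2) * cO q m i := by
  unfold cE cO
  have k1 : ((m + 1 : ℕ) : ℤ) + 1 - 5 * i = m + 2 - 5 * i := by push_cast; ring
  have k2 : ((m + 1 : ℕ) : ℤ) - 2 - 5 * i = m - 1 - 5 * i := by push_cast; ring
  have k3 : ((m + 1 : ℕ) : ℤ) - 1 - 5 * i = m - 5 * i := by push_cast; ring
  rw [k1, k2, k3, show 2 * (m + 1) = 2 * m + 1 + 1 by ring]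
  have e1 := B_eq2 hq (2 * m + 1 + 1) (m + 2 - 5 * i) (m + 1 - 5 * i) (m + 1 + 5 * i)
    (by ring) (by push_cast; ring)
  have e2 := B_eq q (2 * m + 1) (m + 1 - 5 * i) (m - 5 * i) (by ring)
  have e3 := B_eq q (2 * m + 1 + 1) (m - 5 * i) (m - 1 - 5 * i) (by ring)
  have e4 := B_eq2 hq (2 * m + 1) (m - 5 * i) (m - 1 - 5 * i) (m + 2 + 5 * i)
    (by ring) (by push_cast; ring)
  have h1 := zmul hq (a := 10 * i ^ 2 - 3 * i) (b := m + 1 + 5 * i)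
    (c := 10 * i ^ 2 + 2 * i + m + 1) (by ring)
  have h2 := zmul hq (a := 10 * i ^ 2 + 7 * i + 1) (b := m - 5 * i)
    (c := 10 * i ^ 2 + 2 * i + m + 1) (by ring)
  have h3 := zmul hq (a := 10 * i ^ 2 + 2 * i + m + 1) (b := m + 1 - 5 * i)
    (c := (2 * m + 2 : ℕ) + (10 * i ^ 2 - 3 * i)) (by push_cast; ring)
  have h4 := zmul hq (a := 10 * i ^ 2 + 2 * i + m + 1) (b := m + 2 + 5 * i)
    (c := (2 * m + 2 : ℕ) + (10 * i ^ 2 + 7 * i + 1)) (by push_cast; ring)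
  rw [zpow_add₀ hq ((2 * m + 2 : ℕ) : ℤ), zpow_natCast] at h3 h4
  set Y := q ^ (10 * i ^ 2 + 2 * i + (m : ℤ) + 1)
  rw [e1, e3]
  linear_combination B q (2 * m + 1 + 1) (m + 1 - 5 * i) * h1
    - B q (2 * m + 1 + 1) (m - 5 * i) * h2 + Y * e2 - Y * e4
    + B q (2 * m + 1) (m + 1 - 5 * i) * h3 - B q (2 * m + 1) (m - 1 - 5 * i) * h4

/-- truncated bilateral sum -/
noncomputable def S (N : ℕ) (g : ℤ → ℂ) : ℂ := ∑ t ∈ Finset.range (2 * N), g ((t : ℤ) - N)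

theorem S_tele (N : ℕ) (g : ℤ → ℂ) : S N (fun i => g i - g (i + 1)) = g (-N) - g N := by
  unfold S
  have := Finset.sum_range_sub' (fun t : ℕ => g ((t : ℤ) - N)) (2 * N)
  simp only [Nat.cast_add, Nat.cast_one, Nat.cast_mul, Nat.cast_ofNat, Nat.cast_zero] at this
  rw [show (0 : ℤ) - N = -N by ring, show (2 : ℤ) * N - N = N by ring] at this
  rw [← this]
  refine Finset.sum_congr rfl fun t _ => ?_
  rw [show (t : ℤ) + 1 - N = t - N + 1 by ring]

theorem S_single (N : ℕ) (g : ℤ → ℂ) (i : ℤ) (h1 : -N ≤ i) (h2 : i < N)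
    (h : ∀ j, j ≠ i → g j = 0) : S N g = g i := by
  unfold S
  rw [Finset.sum_eq_single (i + N).toNat]
  · congr 1; omega
  · intro t _ ht; apply h; omega
  · intro ht; simp at ht; omega

theorem S_zero (N : ℕ) (g : ℤ → ℂ) (h : ∀ j, g j = 0) : S N g = 0 := by
  unfold S; exact Finset.sum_eq_zero fun t _ => h _

theorem S_d {q : ℂ} (hq : q ≠ 0) (N m : ℕ) (h : m + 2 ≤ N) :
    S N (d q m) = q ^ (2 * m + 1) * S N (cE q m) := by
  have ht := S_tele N (f q m)
  have f1 : f q m (-N) = 0 := by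
    unfold f; rw [B_gt, mul_zero]; push_cast; omega
  have f2 : f q m N = 0 := by
    unfold f; rw [B_neg, mul_zero]; omega
  rw [f1, f2, sub_zero] at ht
  unfold S at *
  rw [Finset.mul_sum, ← add_zero (∑ t ∈ Finset.range (2 * N), _ * _), ← ht,
    ← Finset.sum_add_distrib]
  exact Finset.sum_congr rfl fun t _ => d_eq hq m _

theorem S_cE {q : ℂ} (hq : q ≠ 0) (N m : ℕ) :
    S N (cE q (m + 1)) = S N (cO q m) + S N (d q m) := by
  unfold S
  rw [← Finset.sum_add_distrib]
  exact Finset.sum_congr rfl fun t _ => by rw [← cE_sub hq]; ring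

theorem S_cO {q : ℂ} (hq : q ≠ 0) (N m : ℕ) :
    S N (cO q (m + 1)) = S N (cE q (m + 1)) + q ^ (2 * m + 2) * S N (cO q m) := by
  unfold S
  rw [Finset.mul_sum, ← Finset.sum_add_distrib]
  exact Finset.sum_congr rfl fun t _ => cO_eq hq m _

theorem main {q : ℂ} (hq : q ≠ 0) (N : ℕ) (m : ℕ) : m + 2 ≤ N →
    aeval q (qFhat (2 * m)) = S N (cE q m) ∧ aeval q (qFhat (2 * m + 1)) = S N (cO q m) := by
  induction m with
  | zero =>
    intro hN
    constructor
    · rw [S_zero]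
      · simp [qFhat]
      · intro j
        simp only [cE, B, mul_zero]
        rw [if_neg (by push_cast; omega), if_neg (by push_cast; omega)]; simp
    · rw [S_single N _ 0 (by omega) (by omega)]
      · have h1 := B_self q 1
        have h2 := B_neg q 1 (-1) (by omega)
        simp [qFhat, cO] at *
        simp [h1, h2]
      · intro j hj
        have h1 : B q 1 (1 - 5 * j) = 0 := by
          rcases lt_or_gt_of_ne hj with h | h
          · exact B_gt _ _ _ (by push_cast; omega)
          · exact B_neg _ _ _ (by omega)
        have h2 : B q 1 (-1 - 5 * j) = 0 := by
          rcases lt_or_gt_of_ne hj with h | h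
          · exact B_gt _ _ _ (by push_cast; omega)
          · exact B_neg _ _ _ (by omega)
        simp [cO, h1, h2]
  | succ m ih =>
    intro hN
    obtain ⟨h1, h2⟩ := ih (by omega)
    have h3 : aeval q (qFhat (2 * (m + 1))) = S N (cE q (m + 1)) := by
      rw [show 2 * (m + 1) = 2 * m + 2 by ring, qFhat, S_cE hq, S_d hq N m (by omega)]
      simp [h1, h2]
    refine ⟨h3, ?_⟩
    rw [show 2 * (m + 1) + 1 = (2 * m + 1) + 2 by ring, qFhat, S_cO hq, ← h3, ← h2]
    simp [show 2 * (m + 1) = 2 * m + 1 + 1 by ring]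

theorem value {q : ℂ} (m : ℕ) (hm : m % 5 ≠ 2) (hq : IsPrimitiveRoot q (2 * m + 1)) :
    aeval q (qFhat (2 * m)) = if m % 5 = 1 ∨ m % 5 = 3 then 1 else 0 := by
  have hp : 2 * m + 1 ≠ 0 := by omega
  have hq0 := hq.ne_zero hp
  have key : aeval q (qFhat (2 * m)) = S (m + 2) (d q m) := by
    rw [(main hq0 (m + 2) m le_rfl).1, S_d hq0 _ _ le_rfl, hq.pow_eq_one, one_mul]
  rw [key]
  have b2 : ∀ j : ℤ, B q (2 * m + 1) (m - 2 - 5 * j) = 0 := fun j =>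
    B_prime hp hq _ (by omega) (by push_cast; omega)
  have hd : ∀ j : ℤ, (m : ℤ) + 2 - 5 * j ≠ 0 → (m : ℤ) + 2 - 5 * j ≠ 2 * m + 1 →
      d q m j = 0 := by
    intro j h1 h2
    unfold d
    rw [b2, B_prime hp hq _ h1 (by push_cast; exact h2)]; simp
  by_cases c1 : m % 5 = 1
  · rw [if_pos (Or.inl c1)]
    obtain ⟨r, rfl⟩ : ∃ r, m = 5 * r + 1 := ⟨m / 5, by omega⟩
    rw [S_single _ _ (-(r : ℤ)) (by push_cast; omega) (by push_cast; omega)]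
    · unfold d
      rw [b2]
      have e : ((5 * r + 1 : ℕ) : ℤ) + 2 - 5 * (-(r : ℤ)) = ((2 * (5 * r + 1) + 1 : ℕ) : ℤ) := by
        push_cast; ring
      rw [e, B_self]
      have : q ^ (10 * (-(r : ℤ)) ^ 2 - 8 * (-(r : ℤ)) + ((5 * r + 1 : ℕ) : ℤ) + 2) = 1 := by
        rw [hq.zpow_eq_one_iff_dvd]
        exact ⟨r + 1, by push_cast; ring⟩
      rw [this]; simp
    · intro j hj
      apply hd <;> push_cast <;> omega
  by_cases c2 : m % 5 = 3
  · rw [if_pos (Or.inr c2)]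
    obtain ⟨r, rfl⟩ : ∃ r, m = 5 * r + 3 := ⟨m / 5, by omega⟩
    rw [S_single _ _ ((r : ℤ) + 1) (by push_cast; omega) (by push_cast; omega)]
    · unfold d
      rw [b2]
      have e : ((5 * r + 3 : ℕ) : ℤ) + 2 - 5 * ((r : ℤ) + 1) = 0 := by
        push_cast; ring
      rw [e, B_zero]
      have : q ^ (10 * ((r : ℤ) + 1) ^ 2 - 8 * ((r : ℤ) + 1) + ((5 * r + 3 : ℕ) : ℤ) + 2) = 1 := by
        rw [hq.zpow_eq_one_iff_dvd]
        exact ⟨r + 1, by push_cast; ring⟩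
      rw [this]; simp
    · intro j hj
      apply hd <;> push_cast <;> omega
  rw [if_neg (by tauto)]
  apply S_zero
  intro j
  apply hd <;> omega

theorem fact5 : Fact (Nat.Prime 5) := ⟨Nat.prime_five⟩

attribute [local instance] fact5

theorem leg (p : ℕ) [hp : Fact p.Prime] (hodd : Odd p) (hp5 : p ≠ 5) :
    legendreSym p 5 = if p % 5 = 2 ∨ p % 5 = 3 then -1 else 1 := by
  have h2 : p ≠ 2 := by rintro rfl; revert hodd; decide
  have h := legendreSym.quadratic_reciprocity_one_mod_four (p := 5) (q := p) (by norm_num) h2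
  have h' : legendreSym p 5 = legendreSym 5 p := by exact_mod_cast h
  have h5 : p % 5 ≠ 0 := fun h0 =>
    hp5 (((Nat.prime_dvd_prime_iff_eq (by norm_num) hp.out).1 (Nat.dvd_of_mod_eq_zero h0)).symm)
  rw [h', legendreSym.mod]
  have : p % 5 = 1 ∨ p % 5 = 2 ∨ p % 5 = 3 ∨ p % 5 = 4 := by omega
  have hc : (p : ℤ) % ((5 : ℕ) : ℤ) = ((p % 5 : ℕ) : ℤ) := by push_cast; rfl
  rw [hc]
  rcases this with h | h | h | h <;> rw [h] <;> decide

end QFibAux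

open QFibAux in
/-- For an odd prime p ≠ 5, F̂_{p−1}(q) ≡ (1 − (5/p))/2 (mod [p]_q) in ℤ[q]. -/
theorem qFibHat_pred_prime_congr (p : ℕ) (hp : p.Prime) (hodd : Odd p) (hp5 : p ≠ 5) :
    qbracket p ∣ qFhat (p - 1) - C ((1 - @legendreSym p ⟨hp⟩ 5) / 2) := by
  haveI : Fact p.Prime := ⟨hp⟩
  have hζ := Complex.isPrimitiveRoot_exp p hp.ne_zero
  set ζ := Complex.exp (2 * Real.pi * Complex.I / p)
  have hb : qbracket p = minpoly ℤ ζ := by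
    rw [← cyclotomic_eq_minpoly hζ hp.pos, cyclotomic_prime]; rfl
  rw [hb]
  apply minpoly.isIntegrallyClosed_dvd (hζ.isIntegral hp.pos)
  have h5 : p % 5 ≠ 0 := fun h0 =>
    hp5 (((Nat.prime_dvd_prime_iff_eq (by norm_num) hp).1 (Nat.dvd_of_mod_eq_zero h0)).symm)
  have hl := leg p hodd hp5
  rw [hl]
  clear_value ζ
  clear hl hb
  obtain ⟨m, rfl⟩ := hodd
  rw [Nat.add_sub_cancel, map_sub, value m (by omega) hζ]
  by_cases h : m % 5 = 1 ∨ m % 5 = 3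
  · rw [if_pos h, if_pos (by omega)]; simp
  · rw [if_neg h, if_neg (by omega)]; simp
end

section
/- Let p ≠ 5 be an odd prime and let α_p be the unique integer with 1 ≤ α_p ≤ 4 and α_p·p ≡ 1 (mod 5). Then F̂_p(q) ≡ (5/p) · q^{(α_p·p−1)/5} (mod [p]_q) in ℤ[q], where (5/p) is the Legendre symbol and the exponent (α_p·p−1)/5 is an integer. -/
open Polynomial

/-- q-binomial coefficients with integer lower index. -/
noncomputable def qB (q : ℂ) : ℕ → ℤ → ℂ
  | 0, k => if k = 0 then 1 else 0
  | n + 1, k => qB q n (k - 1) + q ^ k * qB q n k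

lemma qB_succ (q : ℂ) (n : ℕ) (k : ℤ) :
    qB q (n + 1) k = qB q n (k - 1) + q ^ k * qB q n k := rfl

lemma qB_succ' (q : ℂ) (hq : q ≠ 0) (n : ℕ) (k : ℤ) :
    qB q (n + 1) k = q ^ ((n : ℤ) + 1 - k) * qB q n (k - 1) + qB q n k := by
  induction n generalizing k with
  | zero =>
    simp only [qB]
    by_cases h0 : k = 0
    · subst h0; simp
    · by_cases h1 : k = 1
      · subst h1; simp
      · have : k - 1 ≠ 0 := by omega
        simp [h0, this]
  | succ n ih =>
    have h1 := qB_succ q (n + 1) k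
    have h2 := ih (k - 1)
    have h3 := qB_succ q n (k - 1)
    have h4 := ih k
    have h5 := qB_succ q n k
    have e1 : q ^ (((n + 1 : ℕ) : ℤ) + 1 - k) * q ^ (k - 1) = q ^ k * q ^ ((n : ℤ) + 1 - k) := by
      rw [← zpow_add₀ hq, ← zpow_add₀ hq]; congr 1; push_cast; ring
    have e2 : (n : ℤ) + 1 - (k - 1) = ((n + 1 : ℕ) : ℤ) + 1 - k := by push_cast; ring
    rw [e2] at h2
    linear_combination h1 + h2 + q ^ k * h4 - q ^ (((n + 1 : ℕ) : ℤ) + 1 - k) * h3 - h5 - (qB q n (k - 1)) * e1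

lemma qB_neg (q : ℂ) (n : ℕ) (k : ℤ) (hk : k < 0) : qB q n k = 0 := by
  induction n generalizing k with
  | zero => simp [qB, hk.ne]
  | succ n ih => rw [qB_succ, ih _ hk, ih _ (by omega)]; simp

lemma qB_gt (q : ℂ) (n : ℕ) (k : ℤ) (hk : (n : ℤ) < k) : qB q n k = 0 := by
  induction n generalizing k with
  | zero => have : k ≠ 0 := by push_cast at hk; omega
            simp [qB, this]
  | succ n ih =>
    push_cast at hk
    rw [qB_succ, ih _ (by omega), ih _ (by omega)]; simp

lemma qB_zero (q : ℂ) (n : ℕ) : qB q n 0 = 1 := by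
  induction n with
  | zero => simp [qB]
  | succ n ih => rw [qB_succ, ih, qB_neg _ _ _ (by omega)]; simp

lemma qB_self (q : ℂ) (n : ℕ) : qB q n n = 1 := by
  induction n with
  | zero => simp [qB]
  | succ n ih =>
    rw [qB_succ, qB_gt q n ((n + 1 : ℕ) : ℤ) (by push_cast; omega)]; push_cast; simp [ih]

lemma qB_prime (q : ℂ) (p : ℕ) (hq : IsPrimitiveRoot q p) (hp : 0 < p) (k : ℕ)
    (hk : k + 1 < p) : qB q p ((k + 1 : ℕ) : ℤ) = 0 := by
  have hq0 : q ≠ 0 := hq.ne_zero hp.ne'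
  have key : ∀ k : ℤ, (1 - q ^ k) * qB q p k = (1 - q ^ (1 - k)) * qB q p (k - 1) := by
    intro k
    have h1 := qB_succ q p k
    rw [qB_succ' q hq0 p k] at h1
    have : q ^ ((p : ℤ) + 1 - k) = q ^ (1 - k) := by
      rw [add_sub_assoc, zpow_add₀ hq0, zpow_natCast, hq.pow_eq_one, one_mul]
    rw [this] at h1
    linear_combination h1
  have ne : ∀ k : ℕ, k + 1 < p → (1 - q ^ ((k + 1 : ℕ) : ℤ)) ≠ 0 := by
    intro k hk h
    rw [zpow_natCast] at h
    exact hq.pow_ne_one_of_pos_of_lt (by omega) hk (sub_eq_zero.mp h).symm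
  induction k with
  | zero =>
    have := key ((0 + 1 : ℕ) : ℤ)
    have h2 := ne 0 hk
    apply (mul_eq_zero.mp _).resolve_left h2
    rw [this]; simp
  | succ k ih =>
    have := key ((k + 1 + 1 : ℕ) : ℤ)
    have h2 := ne (k + 1) hk
    apply (mul_eq_zero.mp _).resolve_left h2
    rw [this]
    have e : ((k + 1 + 1 : ℕ) : ℤ) - 1 = ((k + 1 : ℕ) : ℤ) := by push_cast; ring
    rw [e, ih (by omega), mul_zero]

/-- exponent -/
def ee (j : ℤ) : ℤ := j * (5 * j + 3) / 2

lemma two_ee (j : ℤ) : 2 * ee j = j * (5 * j + 3) := by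
  unfold ee
  apply Int.mul_ediv_cancel'
  rcases Int.even_or_odd' j with ⟨m, h | h⟩
  · exact ⟨m * (5 * j + 3), by rw [h]; ring⟩
  · exact ⟨j * (5 * m + 4), by rw [h]; ring⟩

lemma ee_succ (j : ℤ) : ee (j + 1) = ee j + 5 * j + 4 := by
  have h1 := two_ee j
  have h2 := two_ee (j + 1)
  linarith

noncomputable def tm (q : ℂ) (n : ℕ) (j : ℤ) : ℂ :=
  (-1) ^ j * q ^ ee j * qB q n (((n : ℤ) - 1 - 5 * j) / 2)

noncomputable def tS (q : ℂ) (n : ℕ) (j : ℤ) : ℂ :=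
  if ((n : ℤ) - 1 - 5 * j) % 2 = 0 then
    (-1) ^ j * q ^ (ee j + ((n : ℤ) - 1 - 5 * j) / 2 + 1) * qB q n (((n : ℤ) - 1 - 5 * j) / 2 + 1)
  else 0

lemma tm_rec (q : ℂ) (hq : q ≠ 0) (n : ℕ) (j : ℤ) :
    tm q (n + 2) j = tm q (n + 1) j + q ^ (n + 1) * tm q n j + (tS q n j - tS q n (j + 1)) := by
  obtain ⟨k, hk | hk⟩ := Int.even_or_odd' ((n : ℤ) - 1 - 5 * j)
  · have a0 : ((n : ℤ) - 1 - 5 * j) / 2 = k := by omega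
    have a1 : (((n + 1 : ℕ) : ℤ) - 1 - 5 * j) / 2 = k := by push_cast; omega
    have a2 : (((n + 2 : ℕ) : ℤ) - 1 - 5 * j) / 2 = k + 1 := by push_cast; omega
    have s0 : ((n : ℤ) - 1 - 5 * j) % 2 = 0 := by omega
    have s1 : ¬ ((n : ℤ) - 1 - 5 * (j + 1)) % 2 = 0 := by omega
    unfold tm tS
    rw [if_pos s0, if_neg s1, a0, a1, a2, qB_succ q (n + 1) (k + 1), qB_succ' q hq n (k + 1),
      add_sub_cancel_right]
    have e1 : q ^ (ee j + k + 1) = q ^ ee j * q ^ (k + 1) := by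
      rw [← zpow_add₀ hq]; congr 1; ring
    have e2 : q ^ (k + 1) * q ^ ((n : ℤ) + 1 - (k + 1)) = q ^ (n + 1) := by
      rw [← zpow_add₀ hq, ← zpow_natCast]; congr 1; push_cast; ring
    rw [e1]
    linear_combination (-1) ^ j * q ^ ee j * qB q n k * e2
  · have a0 : ((n : ℤ) - 1 - 5 * j) / 2 = k := by omega
    have a1 : (((n + 1 : ℕ) : ℤ) - 1 - 5 * j) / 2 = k + 1 := by push_cast; omega
    have a2 : (((n + 2 : ℕ) : ℤ) - 1 - 5 * j) / 2 = k + 1 := by push_cast; omega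
    have a3 : ((n : ℤ) - 1 - 5 * (j + 1)) / 2 = k - 2 := by omega
    have s0 : ¬ ((n : ℤ) - 1 - 5 * j) % 2 = 0 := by omega
    have s1 : ((n : ℤ) - 1 - 5 * (j + 1)) % 2 = 0 := by omega
    unfold tm tS
    rw [if_neg s0, if_pos s1, a0, a1, a2, a3, qB_succ' q hq (n + 1) (k + 1),
      add_sub_cancel_right, qB_succ q n k, ee_succ, zpow_add_one₀ (by norm_num : (-1 : ℂ) ≠ 0)]
    have e0 : k - 2 + 1 = k - 1 := by ring
    have e1 : q ^ (ee j + 5 * j + 4 + (k - 2) + 1)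
        = q ^ ee j * q ^ (((n + 1 : ℕ) : ℤ) + 1 - (k + 1)) := by
      rw [← zpow_add₀ hq]; congr 1; push_cast; linarith
    have e2 : q ^ (((n + 1 : ℕ) : ℤ) + 1 - (k + 1)) * q ^ k = q ^ (n + 1) := by
      rw [← zpow_add₀ hq, ← zpow_natCast]; congr 1; push_cast; ring
    rw [e0, e1]
    linear_combination (-1) ^ j * q ^ ee j * qB q n k * e2

lemma tS_big (q : ℂ) (n N : ℕ) (j : ℤ) (hN : n + 2 ≤ N) (hj : j ≤ -N ∨ (N : ℤ) ≤ j) :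
    tS q n j = 0 := by
  unfold tS
  split_ifs
  · rcases hj with hj | hj
    · rw [qB_gt _ _ _ (by omega), mul_zero]
    · rw [qB_neg _ _ _ (by omega), mul_zero]
  · rfl

lemma schur_s3 (q : ℂ) (hq : q ≠ 0) (N n : ℕ) (hN : n + 2 ≤ N) :
    (qFhat n).eval₂ (Int.castRingHom ℂ) q = ∑ i ∈ Finset.range (2 * N), tm q n ((i : ℤ) - N) := by
  induction n using Nat.strong_induction_on with
  | _ n ih =>
    match n, ih, hN with
    | 0, _, hN =>
      rw [Finset.sum_eq_zero]
      · simp [qFhat]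
      · intro i _
        unfold tm
        have : ¬ ((((0 : ℕ) : ℤ) - 1 - 5 * ((i : ℤ) - N)) / 2 = 0) := by push_cast; omega
        simp only [qB]
        rw [if_neg this, mul_zero]
    | 1, _, hN =>
      rw [Finset.sum_eq_single N]
      · simp [qFhat, tm, qB_zero, ee]
      · intro i _ hi
        unfold tm
        rcases lt_or_gt_of_ne hi with h | h
        · rw [qB_gt _ _ _ (by push_cast; omega), mul_zero]
        · rw [qB_neg _ _ _ (by push_cast; omega), mul_zero]
      · intro h; exact absurd (Finset.mem_range.mpr (by omega)) h
    | n + 2, ih, hN =>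
      rw [qFhat, eval₂_add, eval₂_mul, eval₂_pow, eval₂_X, ih (n + 1) (by omega) (by omega),
        ih n (by omega) (by omega)]
      simp only [tm_rec q hq n]
      rw [Finset.sum_add_distrib, Finset.sum_add_distrib, Finset.mul_sum]
      have := Finset.sum_range_sub' (fun i : ℕ => tS q n ((i : ℤ) - N)) (2 * N)
      have e : ∀ i : ℕ, ((i + 1 : ℕ) : ℤ) - N = (i : ℤ) - N + 1 := by intro i; push_cast; ring
      simp only [e] at this
      rw [this, tS_big q n N _ (by omega) (Or.inl (by push_cast; omega)),
        tS_big q n N _ (by omega) (Or.inr (by push_cast; omega))]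
      simp

lemma schur_prime (q : ℂ) (p : ℕ) (hq : IsPrimitiveRoot q p) (hp : 0 < p) (j : ℤ)
    (hj : ((p : ℤ) - 1 - 5 * j) / 2 = 0 ∨ ((p : ℤ) - 1 - 5 * j) / 2 = p)
    (hu : ∀ i : ℤ, (((p : ℤ) - 1 - 5 * i) / 2 = 0 ∨ ((p : ℤ) - 1 - 5 * i) / 2 = p) → i = j) :
    (qFhat p).eval₂ (Int.castRingHom ℂ) q = (-1) ^ j * q ^ ee j := by
  rw [schur_s3 q (hq.ne_zero hp.ne') (p + 2) p le_rfl]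
  rw [Finset.sum_eq_single (j + (p + 2)).toNat]
  · have : (((j + (p + 2)).toNat : ℕ) : ℤ) - ((p + 2 : ℕ) : ℤ) = j := by push_cast; omega
    rw [this]
    unfold tm
    rcases hj with h | h <;> rw [h]
    · rw [qB_zero, mul_one]
    · rw [qB_self, mul_one]
  · intro i _ hi
    unfold tm
    generalize hx : (i : ℤ) - ((p + 2 : ℕ) : ℤ) = x
    have hxj : x ≠ j := by push_cast at hx; omega
    have hnot := mt (hu x) hxj
    push Not at hnot
    generalize ((p : ℤ) - 1 - 5 * x) / 2 = k at hnot
    rcases lt_or_ge k 0 with h | h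
    · rw [qB_neg _ _ _ h, mul_zero]
    · rcases lt_or_ge (p : ℤ) k with h' | h'
      · rw [qB_gt _ _ _ h', mul_zero]
      · have : k = (((k.toNat - 1) + 1 : ℕ) : ℤ) := by omega
        rw [this, qB_prime q p hq hp _ (by omega), mul_zero]
  · intro h
    exfalso
    apply h
    rw [Finset.mem_range]
    omega

lemma dvd_of_eval (p : ℕ) (hp : p.Prime) (q : ℂ) (hq : IsPrimitiveRoot q p) (f : Polynomial ℤ)
    (hf : f.eval₂ (Int.castRingHom ℂ) q = 0) : qbracket p ∣ f := by
  have : Fact p.Prime := ⟨hp⟩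
  have h : qbracket p = minpoly ℤ q := by
    rw [← cyclotomic_eq_minpoly hq hp.pos, cyclotomic_prime]; rfl
  rw [h]
  apply minpoly.isIntegrallyClosed_dvd (hq.isIntegral hp.pos)
  rw [aeval_def]
  exact hf

lemma zpow_congr (q : ℂ) (p : ℕ) (hq : IsPrimitiveRoot q p) (hp : 0 < p) (a b c : ℤ)
    (h : a = b + p * c) : q ^ a = q ^ b := by
  rw [h, zpow_add₀ (hq.ne_zero hp.ne'), zpow_mul, zpow_natCast, hq.pow_eq_one, one_zpow, mul_one]

lemma leg (p : ℕ) [Fact p.Prime] (hodd : Odd p) :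
    legendreSym p 5 = if p % 5 = 1 ∨ p % 5 = 4 then 1 else if p % 5 = 0 then 0 else -1 := by
  have : Fact (Nat.Prime 5) := ⟨by norm_num⟩
  have h := legendreSym.quadratic_reciprocity_one_mod_four (p := 5) (q := p) (by norm_num)
    (by rintro rfl; exact absurd hodd (by decide))
  have h' : legendreSym p 5 = legendreSym 5 p := by exact_mod_cast h
  rw [h', legendreSym.mod]
  have : p % 5 < 5 := Nat.mod_lt _ (by norm_num)
  have e : ((p : ℤ) % ((5 : ℕ) : ℤ)) = ((p % 5 : ℕ) : ℤ) := by push_cast; rfl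
  rw [e]
  generalize p % 5 = r at this
  clear e h h'
  interval_cases r <;> decide +revert

theorem qFibHat_prime_congr (p : ℕ) (hp : p.Prime) (hodd : Odd p) (hp5 : p ≠ 5)
    (α : ℤ) (hα1 : 1 ≤ α) (hα4 : α ≤ 4) (hαp : α * p ≡ 1 [ZMOD 5]) :
    (5 : ℤ) ∣ α * p - 1 ∧
      qbracket p ∣
        qFhat p - C (@legendreSym p ⟨hp⟩ 5) * X ^ ((α * (p : ℤ) - 1) / 5).toNat := by
  have hd : (5 : ℤ) ∣ α * p - 1 := hαp.symm.dvd
  refine ⟨hd, ?_⟩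
  have : Fact p.Prime := ⟨hp⟩
  have hpos := hp.pos
  have hq := Complex.isPrimitiveRoot_exp p hp.ne_zero
  generalize Complex.exp (2 * Real.pi * Complex.I / p) = q at hq
  apply dvd_of_eval p hp q hq
  rw [eval₂_sub, eval₂_mul, eval₂_C, eval₂_pow, eval₂_X, leg p hodd]
  have h0 : p % 5 ≠ 0 := by
    intro h
    exact hp5 ((Nat.prime_dvd_prime_iff_eq (by norm_num) hp).mp (Nat.dvd_of_mod_eq_zero h)).symm
  obtain ⟨m, hm⟩ := hodd
  have hr : p % 5 = 1 ∨ p % 5 = 2 ∨ p % 5 = 3 ∨ p % 5 = 4 := by omega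
  rw [← zpow_natCast, Int.toNat_of_nonneg
    (Int.ediv_nonneg (by nlinarith [(by exact_mod_cast hpos : (1 : ℤ) ≤ p)]) (by norm_num))]
  rcases hr with h | h | h | h
  · have hα : α = 1 := by interval_cases α <;> omega
    subst hα
    obtain ⟨c, hc⟩ : ∃ c : ℤ, (p : ℤ) = 10 * c + 1 := ⟨p / 10, by omega⟩
    rw [schur_prime q p hq hpos (2 * c) (by omega) (by omega),
      zpow_congr q p hq hpos (ee (2 * c)) ((1 * (p : ℤ) - 1) / 5) c]
    · simp [h, zpow_mul]
    · have := two_ee (2 * c)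
      have e : (1 * (p : ℤ) - 1) / 5 = 2 * c := by omega
      rw [e, hc]; nlinarith
  · have hα : α = 3 := by interval_cases α <;> omega
    subst hα
    obtain ⟨c, hc⟩ : ∃ c : ℤ, (p : ℤ) = 10 * c + 7 := ⟨p / 10, by omega⟩
    rw [schur_prime q p hq hpos (2 * c + 1) (by omega) (by omega),
      zpow_congr q p hq hpos (ee (2 * c + 1)) ((3 * (p : ℤ) - 1) / 5) c]
    · simp [h, zpow_mul, zpow_add₀]
    · have := two_ee (2 * c + 1)
      have e : (3 * (p : ℤ) - 1) / 5 = 6 * c + 4 := by omega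
      rw [e, hc]; nlinarith
  · have hα : α = 2 := by interval_cases α <;> omega
    subst hα
    obtain ⟨c, hc⟩ : ∃ c : ℤ, (p : ℤ) = 10 * c + 3 := ⟨p / 10, by omega⟩
    rw [schur_prime q p hq hpos (2 * (-c - 1) + 1) (by omega) (by omega),
      zpow_congr q p hq hpos (ee (2 * (-c - 1) + 1)) ((2 * (p : ℤ) - 1) / 5) c]
    · rw [zpow_add₀ (by norm_num), zpow_mul]; simp [h]
    · have := two_ee (2 * (-c - 1) + 1)
      have e : (2 * (p : ℤ) - 1) / 5 = 4 * c + 1 := by omega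
      rw [e, hc]; nlinarith
  · have hα : α = 4 := by interval_cases α <;> omega
    subst hα
    obtain ⟨c, hc⟩ : ∃ c : ℤ, (p : ℤ) = 10 * c + 9 := ⟨p / 10, by omega⟩
    rw [schur_prime q p hq hpos (2 * (-c - 1)) (by omega) (by omega),
      zpow_congr q p hq hpos (ee (2 * (-c - 1))) ((4 * (p : ℤ) - 1) / 5) c]
    · rw [zpow_mul]; simp [h]
    · have := two_ee (2 * (-c - 1))
      have e : (4 * (p : ℤ) - 1) / 5 = 8 * c + 7 := by omega
      rw [e, hc]; nlinarith
end

section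
/- Let p be an odd prime. Then q^{(p²−1)/8} · P_p(q) ≡ (2/p) (mod [p]_q) in ℤ[q], where (2/p) is the Legendre symbol and (p²−1)/8 is an integer. -/
open Polynomial

/-- The q-Pell polynomials: P₀ = 0, P₁ = 1, Pₙ = (1+q^(n-1)) Pₙ₋₁ + q^(n-2) Pₙ₋₂. -/
noncomputable def qP : ℕ → Polynomial ℤ
  | 0 => 0
  | 1 => 1
  | n + 2 => (1 + X ^ (n + 1)) * qP (n + 1) + X ^ n * qP n
section aux
variable {K : Type*} [Field K]

def auxT (q : K) : ℕ → ℕ → K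
  | 0, 0 => 1
  | 0, _ + 1 => 0
  | 1, 0 => 1 + q
  | 1, _ + 1 => 0
  | N + 2, 0 => (1 + q ^ (N + 2)) * auxT q (N + 1) 0
  | N + 2, j + 1 => (1 + q ^ (N + 2)) * auxT q (N + 1) (j + 1) + q ^ (N + 1) * auxT q N j

def auxU (q : K) : ℕ → ℕ → K
  | 0, 0 => 1
  | 0, _ + 1 => 0
  | h + 1, 0 => auxU q h 0
  | h + 1, j + 1 => auxU q h (j + 1) + q ^ (2 * h + 1) * auxU q h j

def auxQ (q : K) (n : ℕ) : K := ∏ i ∈ Finset.range n, (1 - q ^ (2 * (i + 1)))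
def auxR (q : K) (n : ℕ) : K := ∏ i ∈ Finset.range n, (1 - q ^ (i + 1))

lemma auxQ_succ (q : K) (n : ℕ) : auxQ q (n + 1) = auxQ q n * (1 - q ^ (2 * (n + 1))) :=
  Finset.prod_range_succ _ _
lemma auxR_succ (q : K) (n : ℕ) : auxR q (n + 1) = auxR q n * (1 - q ^ (n + 1)) :=
  Finset.prod_range_succ _ _
lemma auxQ_zero (q : K) : auxQ q 0 = 1 := rfl
lemma auxR_zero (q : K) : auxR q 0 = 1 := rfl

lemma auxT_zero_of_lt (q : K) : ∀ N j, N < 2 * j → auxT q N j = 0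
  | 0, 0, h => by omega
  | 0, _ + 1, _ => by simp [auxT]
  | 1, 0, h => by omega
  | 1, _ + 1, _ => by simp [auxT]
  | N + 2, 0, h => by omega
  | N + 2, j + 1, h => by
    rw [auxT, auxT_zero_of_lt q (N + 1) (j + 1) (by omega),
      auxT_zero_of_lt q N j (by omega)]
    simp

lemma auxU_zero_of_lt (q : K) : ∀ N j, N < j → auxU q N j = 0
  | 0, 0, h => by omega
  | 0, _ + 1, _ => by simp [auxU]
  | N + 1, 0, h => by omega
  | N + 1, j + 1, h => by
    rw [auxU, auxU_zero_of_lt q N (j + 1) (by omega),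
      auxU_zero_of_lt q N j (by omega)]
    simp

lemma auxT_zero_right (q : K) (m : ℕ) : auxT q (m + 1) 0 = (1 + q ^ (m + 1)) * auxT q m 0 := by
  cases m with
  | zero => simp [auxT]
  | succ m => rw [auxT]

lemma auxT_closed (q : K) (j : ℕ) : ∀ m,
    auxT q (2 * j + m) j * auxQ q j * auxR q m = q ^ (j ^ 2) * auxQ q (j + m) := by
  induction j with
  | zero =>
    intro m
    induction m with
    | zero => simp [auxT, auxQ_zero, auxR_zero]
    | succ m ih =>
      simp only [Nat.mul_zero, Nat.zero_add, auxQ_zero] at ih ⊢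
      rw [auxT_zero_right, auxR_succ, auxQ_succ]
      linear_combination (1 + q ^ (m + 1)) * (1 - q ^ (m + 1)) * ih
  | succ j ihj =>
    intro m
    induction m with
    | zero =>
      have h := ihj 0
      rw [show 2 * (j + 1) + 0 = 2 * j + 2 by ring, auxT,
        auxT_zero_of_lt q (2 * j + 1) (j + 1) (by omega)]
      simp only [Nat.add_zero] at h ⊢
      rw [auxQ_succ]
      linear_combination q ^ (2 * j + 1) * (1 - q ^ (2 * (j + 1))) * h
    | succ m ih =>
      have h := ihj (m + 1)
      rw [show 2 * (j + 1) + m = 2 * j + m + 1 + 1 by ring,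
        show j + 1 + m = j + m + 1 by ring] at ih
      rw [show 2 * j + (m + 1) = 2 * j + m + 1 by ring,
        show j + (m + 1) = j + m + 1 by ring] at h
      rw [show 2 * (j + 1) + (m + 1) = (2 * j + m + 1) + 2 by ring, auxT,
        show j + 1 + (m + 1) = (j + m + 1) + 1 by ring, auxQ_succ q (j + m + 1)]
      rw [auxR_succ] at h ⊢
      rw [auxQ_succ q j] at ih ⊢
      linear_combination (1 + q ^ (2 * j + m + 1 + 2)) * (1 - q ^ (m + 1)) * ih
        + q ^ (2 * j + m + 1 + 1) * (1 - q ^ (2 * (j + 1))) * h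

lemma auxU_closed (q : K) (j : ℕ) : ∀ m,
    auxU q (j + m) j * auxQ q j * auxQ q m = q ^ (j ^ 2) * auxQ q (j + m) := by
  induction j with
  | zero =>
    intro m
    induction m with
    | zero => simp [auxU, auxQ_zero]
    | succ m ih =>
      simp only [Nat.zero_add, auxQ_zero] at ih ⊢
      rw [auxU, auxQ_succ]
      linear_combination (1 - q ^ (2 * (m + 1))) * ih
  | succ j ihj =>
    intro m
    induction m with
    | zero =>
      have h := ihj 0
      simp only [Nat.add_zero] at h ⊢
      rw [auxU, auxU_zero_of_lt q j (j + 1) (by omega), auxQ_succ]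
      linear_combination q ^ (2 * j + 1) * (1 - q ^ (2 * (j + 1))) * h
    | succ m ih =>
      have h := ihj (m + 1)
      rw [show j + 1 + m = j + m + 1 by ring] at ih
      rw [show j + (m + 1) = j + m + 1 by ring] at h
      rw [show j + 1 + (m + 1) = (j + m + 1) + 1 by ring, auxU, auxQ_succ q (j + m + 1)]
      rw [auxQ_succ q m] at h ⊢
      rw [auxQ_succ q j] at ih ⊢
      linear_combination (1 - q ^ (2 * (m + 1))) * ih
        + q ^ (2 * (j + m + 1) + 1) * (1 - q ^ (2 * (j + 1))) * h

lemma auxU_sum (q : K) (h : ℕ) : ∀ M, h < M →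
    ∑ j ∈ Finset.range M, auxU q h j = ∏ i ∈ Finset.range h, (1 + q ^ (2 * i + 1)) := by
  induction h with
  | zero =>
    intro M hM
    obtain ⟨M, rfl⟩ := Nat.exists_eq_succ_of_ne_zero hM.ne'
    rw [Finset.sum_range_succ']
    simp [auxU]
  | succ h ih =>
    intro M hM
    obtain ⟨M, rfl⟩ := Nat.exists_eq_succ_of_ne_zero (by omega : M ≠ 0)
    have h1 := ih (M + 1) (by omega)
    have h2 := ih M (by omega)
    rw [Finset.sum_range_succ'] at h1
    rw [Finset.prod_range_succ, Finset.sum_range_succ']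
    simp only [auxU]
    rw [Finset.sum_add_distrib, ← Finset.mul_sum, h2]
    linear_combination h1

lemma auxT_sum (q : ℂ) : ∀ N M, N < M →
    ∑ j ∈ Finset.range M, auxT q N j = aeval q (qP (N + 1))
  | 0, M, hM => by
    obtain ⟨M, rfl⟩ := Nat.exists_eq_succ_of_ne_zero (by omega : M ≠ 0)
    rw [Finset.sum_range_succ']
    simp [auxT, qP]
  | 1, M, hM => by
    obtain ⟨M, rfl⟩ := Nat.exists_eq_succ_of_ne_zero (by omega : M ≠ 0)
    rw [Finset.sum_range_succ']
    simp [auxT, qP]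
  | N + 2, M, hM => by
    obtain ⟨M, rfl⟩ := Nat.exists_eq_succ_of_ne_zero (by omega : M ≠ 0)
    have h1 := auxT_sum q (N + 1) (M + 1) (by omega)
    have h2 := auxT_sum q N M (by omega)
    rw [Finset.sum_range_succ'] at h1 ⊢
    simp only [auxT]
    rw [Finset.sum_add_distrib, ← Finset.mul_sum, ← Finset.mul_sum, h2, qP]
    simp only [map_add, map_mul, map_pow, map_one, aeval_X]
    rw [← h1]
    ring

lemma auxQR (q : K) (h : ℕ) (hq : q ^ (2 * h + 1) = 1) (m : ℕ) :
    auxQ q (h + m) * auxQ q m = auxQ q h * auxR q (2 * m) := by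
  induction m with
  | zero => simp [auxQ_zero, auxR_zero]
  | succ m ih =>
    rw [show h + (m + 1) = h + m + 1 by ring, show 2 * (m + 1) = 2 * m + 1 + 1 by ring,
      auxQ_succ, auxQ_succ, auxR_succ, auxR_succ]
    have e : q ^ (2 * (h + m + 1)) = q ^ (2 * m + 1) := by
      rw [show 2 * (h + m + 1) = (2 * h + 1) + (2 * m + 1) by ring, pow_add, hq, one_mul]
    rw [e]
    linear_combination (1 - q ^ (2 * m + 1)) * (1 - q ^ (2 * m + 1 + 1)) * ih

lemma aux_eval (q : ℂ) (h : ℕ) (hq : IsPrimitiveRoot q (2 * h + 1)) :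
    aeval q (qP (2 * h + 1)) = ∏ i ∈ Finset.range h, (1 + q ^ (2 * i + 1)) := by
  have nz : ∀ i, 0 < i → i < 2 * h + 1 → 1 - q ^ i ≠ 0 := fun i h1 h2 h3 =>
    hq.pow_ne_one_of_pos_of_lt h1.ne' h2 (sub_eq_zero.1 h3).symm
  rw [← auxT_sum q (2 * h) (2 * h + 1) (by omega), ← auxU_sum q h (2 * h + 1) (by omega)]
  refine Finset.sum_congr rfl fun j _ => ?_
  by_cases hj : h < j
  · rw [auxT_zero_of_lt _ _ _ (by omega), auxU_zero_of_lt _ _ _ hj]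
  obtain ⟨m, rfl⟩ := Nat.exists_eq_add_of_le (not_lt.1 hj)
  have h1 := auxT_closed q j (2 * m)
  have h2 := auxU_closed q j m
  have h3 := auxQR q (j + m) hq.pow_eq_one m
  rw [show 2 * j + 2 * m = 2 * (j + m) by ring, show j + 2 * m = j + m + m by ring] at h1
  have nQ : ∀ n, n ≤ j + m → auxQ q n ≠ 0 := fun n hn => by
    refine Finset.prod_ne_zero_iff.2 fun i hi => ?_
    have := Finset.mem_range.1 hi
    have := nz (i + 1) (by omega) (by omega)
    intro h0
    have h4 : q ^ (2 * (i + 1)) = 1 := (sub_eq_zero.1 h0).symm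
    have h5 := (hq.pow_eq_one_iff_dvd _).1 h4
    have h6 : (2 * (j + m) + 1) ∣ i + 1 :=
      (Nat.Coprime.dvd_of_dvd_mul_left (by simp) h5)
    have := Nat.le_of_dvd (by omega) h6
    omega
  have nR : auxR q (2 * m) ≠ 0 := by
    refine Finset.prod_ne_zero_iff.2 fun i hi => ?_
    have := Finset.mem_range.1 hi
    exact nz (i + 1) (by omega) (by omega)
  have n1 := nQ j (by omega)
  have n2 := nQ m (by omega)
  apply mul_right_cancel₀ (mul_ne_zero (mul_ne_zero n1 n2) nR)
  linear_combination auxQ q m * h1 - auxR q (2 * m) * h2 + q ^ (j ^ 2) * h3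

lemma aux_sq (q : ℂ) (h : ℕ) (hq : IsPrimitiveRoot q (2 * h + 1)) :
    (∏ i ∈ Finset.range h, (1 + q ^ (2 * i + 1))) ^ 2 = q ^ (h ^ 2) := by
  have nz : ∀ i, 0 < i → i < 2 * h + 1 → 1 - q ^ i ≠ 0 := fun i h1 h2 h3 =>
    hq.pow_ne_one_of_pos_of_lt h1.ne' h2 (sub_eq_zero.1 h3).symm
  -- `∏ (1+q^(2i+1)) * R_{2h} = Q_h * stuff`
  have hR : auxR q (2 * h) ≠ 0 := by
    refine Finset.prod_ne_zero_iff.2 fun i hi => ?_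
    have := Finset.mem_range.1 hi
    exact nz (i + 1) (by omega) (by omega)
  have hsplit : ∀ k, ∏ i ∈ Finset.range (2 * k), (1 + q ^ (i + 1)) =
      (∏ i ∈ Finset.range k, (1 + q ^ (2 * i + 1))) *
        ∏ i ∈ Finset.range k, (1 + q ^ (2 * i + 2)) := by
    intro k
    induction k with
    | zero => simp
    | succ k ih =>
      rw [show 2 * (k + 1) = 2 * k + 1 + 1 by ring]
      simp only [Finset.prod_range_succ, ih]
      ring
  have hall : ∏ i ∈ Finset.range (2 * h), (1 + q ^ (i + 1)) = 1 := by
    have e : (∏ i ∈ Finset.range (2 * h), (1 + q ^ (i + 1))) * auxR q (2 * h) =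
        auxQ q (2 * h) := by
      rw [auxR, auxQ, ← Finset.prod_mul_distrib]
      exact Finset.prod_congr rfl fun i _ => by ring
    have e2 := auxQR q h hq.pow_eq_one h
    rw [show h + h = 2 * h by ring] at e2
    have nQ : auxQ q h ≠ 0 := by
      refine Finset.prod_ne_zero_iff.2 fun i hi => ?_
      have := Finset.mem_range.1 hi
      exact nz (2 * (i + 1)) (by omega) (by omega)
    apply mul_right_cancel₀ (mul_ne_zero hR nQ)
    linear_combination auxQ q h * e + e2
  have hrefl : (∏ i ∈ Finset.range h, q ^ (2 * i + 1)) *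
      ∏ i ∈ Finset.range h, (1 + q ^ (2 * i + 2)) =
      ∏ i ∈ Finset.range h, (1 + q ^ (2 * i + 1)) := by
    rw [← Finset.prod_range_reflect (fun i => 1 + q ^ (2 * i + 2)), ← Finset.prod_mul_distrib]
    refine Finset.prod_congr rfl fun i hi => ?_
    have := Finset.mem_range.1 hi
    rw [mul_add, ← pow_add, show 2 * i + 1 + (2 * (h - 1 - i) + 2) = 2 * h + 1 by omega,
      hq.pow_eq_one]
    ring
  have hpow : ∀ k, (∏ i ∈ Finset.range k, q ^ (2 * i + 1)) = q ^ (k ^ 2) := by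
    intro k
    induction k with
    | zero => simp
    | succ k ih => rw [Finset.prod_range_succ, ih]; ring
  have h1 := hsplit h
  rw [hall] at h1
  rw [hpow] at hrefl
  linear_combination -(∏ i ∈ Finset.range h, (1 + q ^ (2 * i + 1))) * hrefl - q ^ (h ^ 2) * h1

lemma aux_dvd (p : ℕ) (hp : p.Prime) (q : ℂ) (hq : IsPrimitiveRoot q p) (f : ℤ[X])
    (hf : aeval q f = 0) : qbracket p ∣ f := by
  have : Fact p.Prime := ⟨hp⟩
  rw [qbracket, ← cyclotomic_prime ℤ p, cyclotomic_eq_minpoly hq hp.pos]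
  exact minpoly.isIntegrallyClosed_dvd (hq.isIntegral hp.pos) hf

end aux

/-- For an odd prime p, (p²−1)/8 is an integer and
q^((p²−1)/8)·P_p(q) ≡ (2/p) (mod [p]_q) in ℤ[q]. -/
theorem qPell_prime_congr (p : ℕ) (hp : p.Prime) (hodd : Odd p) :
    8 ∣ p ^ 2 - 1 ∧
      qbracket p ∣ X ^ ((p ^ 2 - 1) / 8) * qP p - C (@legendreSym p ⟨hp⟩ 2) := by
  have : Fact p.Prime := ⟨hp⟩
  have h8 : 8 ∣ p ^ 2 - 1 := Nat.eight_dvd_sq_sub_one_of_odd hodd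
  refine ⟨h8, ?_⟩
  obtain ⟨e, he⟩ := h8
  rw [he, Nat.mul_div_cancel_left _ (by norm_num)]
  obtain ⟨h, rfl⟩ := hodd
  have he2 : 2 * e + h ^ 2 = h * (2 * h + 1) := by
    have : (2 * h + 1) ^ 2 - 1 = 4 * h ^ 2 + 4 * h := by
      rw [show (2 * h + 1) ^ 2 = 4 * h ^ 2 + 4 * h + 1 by ring]; simp
    nlinarith
  obtain ⟨q, hq⟩ : ∃ q : ℂ, IsPrimitiveRoot q (2 * h + 1) :=
    ⟨_, Complex.isPrimitiveRoot_exp _ (by omega)⟩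
  have key : ∃ s : ℤ, (s = 1 ∨ s = -1) ∧
      q ^ e * ∏ i ∈ Finset.range h, (1 + q ^ (2 * i + 1)) = s := by
    have : (q ^ e * ∏ i ∈ Finset.range h, (1 + q ^ (2 * i + 1))) ^ 2 = 1 := by
      rw [mul_pow, aux_sq q h hq, ← pow_mul, ← pow_add, mul_comm e 2, he2, mul_comm, pow_mul,
        hq.pow_eq_one, one_pow]
    rcases eq_or_eq_neg_of_sq_eq_sq _ (1 : ℂ) (by rw [this, one_pow]) with h1 | h1
    · exact ⟨1, Or.inl rfl, by simpa using h1⟩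
    · exact ⟨-1, Or.inr rfl, by simpa using h1⟩
  obtain ⟨s, hs, hsq⟩ := key
  have hd := aux_dvd _ hp q hq
    (X ^ e * ∏ i ∈ Finset.range h, (1 + X ^ (2 * i + 1)) - C s) (by
      simp [map_prod, hsq])
  have hd1 : ((2 * h + 1 : ℕ) : ℤ) ∣ 2 ^ h - s := by
    have := map_dvd (evalRingHom (1 : ℤ)) hd
    simpa [qbracket, eval_finsetSum, eval_prod, one_add_one_eq_two] using this
  have hl := legendreSym.eq_pow (2 * h + 1) 2
  rw [show (2 * h + 1) / 2 = h by omega] at hl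
  have hz : ((s : ℤ) : ZMod (2 * h + 1)) = (legendreSym (2 * h + 1) 2 : ℤ) := by
    rw [hl]
    have := (ZMod.intCast_zmod_eq_zero_iff_dvd (2 ^ h - s) (2 * h + 1)).2 hd1
    push_cast at this ⊢
    exact (sub_eq_zero.1 this).symm
  have hp3 : 3 ≤ 2 * h + 1 := by
    have := hp.two_le
    omega
  have hsl : s = legendreSym (2 * h + 1) 2 := by
    have h20 : ((2 : ℤ) : ZMod (2 * h + 1)) ≠ 0 := by
      intro h0
      have := (ZMod.intCast_zmod_eq_zero_iff_dvd 2 (2 * h + 1)).1 h0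
      have := Int.le_of_dvd (by norm_num) this
      omega
    have hdv := (ZMod.intCast_eq_intCast_iff_dvd_sub _ _ _).1 hz
    have hcases := legendreSym.eq_one_or_neg_one (2 * h + 1) h20
    obtain ⟨c, hc⟩ := hdv
    by_contra hne
    have h2 : ((2 * h + 1 : ℕ) : ℤ) ∣ 2 := by
      rcases hs with rfl | rfl <;> rcases hcases with h4 | h4 <;> rw [h4] at hc hne
      · exact absurd rfl hne
      · exact ⟨-c, by linarith⟩
      · exact ⟨c, by linarith⟩
      · exact absurd rfl hne
    have := Int.le_of_dvd (by norm_num) h2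
    omega
  apply aux_dvd _ hp q hq
  rw [map_sub, map_mul, aux_eval q h hq, map_pow, aeval_X, hsq, ← hsl]
  simp
end

section
/- Let p be an odd prime. Then P̂_p(q) ≡ (2/p) · q^{(p²−1)/8} (mod [p]_q) in ℤ[q], where (2/p) is the Legendre symbol and (p²−1)/8 is an integer. -/
open Polynomial

/-- The q-Pell polynomials: P̂₀ = 0, P̂₁ = 1, P̂ₙ = (1+q^(n-1)) P̂ₙ₋₁ + q^(n-1) P̂ₙ₋₂. -/
noncomputable def qPhat : ℕ → Polynomial ℤ
  | 0 => 0
  | 1 => 1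
  | n + 2 => (1 + X ^ (n + 1)) * qPhat (n + 1) + X ^ (n + 1) * qPhat n
open Finset

/-- Gaussian binomials. -/
def gbin {R : Type*} [CommRing R] (q : R) : ℕ → ℕ → R
  | _, 0 => 1
  | 0, _ + 1 => 0
  | n + 1, k + 1 => gbin q n k + q ^ (k + 1) * gbin q n (k + 1)

section
variable {R : Type*} [CommRing R] (q : R)

lemma gbin_z (n : ℕ) : gbin q n 0 = 1 := by cases n <;> rfl
lemma gbin_zs (k : ℕ) : gbin q 0 (k + 1) = 0 := rfl
lemma gbin_ss (n k : ℕ) :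
    gbin q (n + 1) (k + 1) = gbin q n k + q ^ (k + 1) * gbin q n (k + 1) := rfl

lemma gbin_lt (n : ℕ) : ∀ k, n < k → gbin q n k = 0 := by
  induction n with
  | zero => intro k hk; obtain ⟨j, rfl⟩ : ∃ j, k = j + 1 := ⟨k - 1, by omega⟩; rfl
  | succ n ih =>
    intro k hk
    obtain ⟨j, rfl⟩ : ∃ j, k = j + 1 := ⟨k - 1, by omega⟩
    rw [gbin_ss, ih j (by omega), ih (j + 1) (by omega)]; ring

lemma gbin_pascal (n : ℕ) : ∀ k d, k + d = n →
    gbin q (n + 1) (k + 1) = gbin q n (k + 1) + q ^ d * gbin q n k := by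
  induction n with
  | zero =>
    intro k d h
    obtain ⟨rfl, rfl⟩ : k = 0 ∧ d = 0 := by omega
    simp [gbin]
  | succ n ih =>
    intro k d h
    have h2 : gbin q (n + 2) (k + 1) = gbin q (n + 1) k + q ^ (k + 1) * gbin q (n + 1) (k + 1) :=
      gbin_ss q (n + 1) k
    rcases d with _ | d
    · rw [h2, gbin_lt q (n + 1) (k + 1) (by omega)]; ring
    · have h1 := ih k d (by omega)
      rcases k with _ | k
      · have h3 := gbin_ss q n 0
        have : d = n := by omega
        subst this
        rw [h2]
        simp only [gbin_z] at *
        linear_combination q ^ (0 + 1) * h1 - h3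
      · have h4 := ih k (d + 1) (by omega)
        have h3 := gbin_ss q n (k + 1)
        have h5 := gbin_ss q n k
        rw [h2]
        linear_combination h4 + q ^ (k + 1 + 1) * h1 - h3 - q ^ (d + 1) * h5

lemma gbin_ratio (k d : ℕ) :
    gbin q (k + d) (k + 1) * (1 - q ^ (k + 1)) = gbin q (k + d) k * (1 - q ^ d) := by
  have h1 := gbin_pascal q (k + d) k d rfl
  have h2 := gbin_ss q (k + d) k
  linear_combination h2 - h1

lemma gbin_ratio2 (k d : ℕ) :
    gbin q (k + d + 1) k * (1 - q ^ (d + 1)) = gbin q (k + d) k * (1 - q ^ (k + d + 1)) := by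
  rcases k with _ | k
  · simp [gbin_z]
  · have h1 := gbin_pascal q (k + (d + 1)) k (d + 1) rfl
    have h2 := gbin_ratio q k (d + 1)
    rw [show k + 1 + d = k + (d + 1) by ring]
    rw [h1]
    linear_combination - q ^ (d + 1) * h2

lemma gbin_thm (M : ℕ) : ∀ z : R,
    ∑ k ∈ range (M + 1), q ^ (k * (k + 1)) * gbin (q ^ 2) M k * z ^ k
      = ∏ i ∈ range M, (1 + z * q ^ (2 * (i + 1))) := by
  induction M with
  | zero => intro z; simp [gbin_z]
  | succ M ih =>
    intro z
    have h := ih (z * q ^ 2)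
    rw [prod_range_succ', sum_range_succ']
    have e1 : ∏ i ∈ range M, (1 + z * q ^ (2 * (i + 1 + 1)))
        = ∏ i ∈ range M, (1 + z * q ^ 2 * q ^ (2 * (i + 1))) :=
      prod_congr rfl fun i _ => by ring
    rw [e1, ← h]
    have e2 : ∀ k ∈ range (M + 1),
        q ^ ((k + 1) * (k + 1 + 1)) * gbin (q ^ 2) (M + 1) (k + 1) * z ^ (k + 1)
        = z * q ^ 2 * (q ^ (k * (k + 1)) * gbin (q ^ 2) M k * (z * q ^ 2) ^ k)
          + q ^ ((k + 1) * (k + 1 + 1)) * gbin (q ^ 2) M (k + 1) * (z * q ^ 2) ^ (k + 1) := by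
      intro k _
      rw [gbin_ss]; ring
    rw [sum_congr rfl e2, sum_add_distrib, ← mul_sum]
    have e3 := sum_range_succ' (fun k => q ^ (k * (k + 1)) * gbin (q ^ 2) M k * (z * q ^ 2) ^ k)
      (M + 1)
    rw [sum_range_succ, gbin_lt (q ^ 2) M (M + 1) (by omega)] at e3
    simp only [gbin_z] at e3 ⊢
    linear_combination -e3

/-- The summand. -/
def Dterm (k m : ℕ) : R := q ^ (k * (k + 1)) * gbin q m k * ∏ i ∈ Ioc k m, (1 + q ^ i)

lemma Dterm_s0 (k : ℕ) : Dterm q (k + 1) 0 = 0 := by simp [Dterm, gbin_zs]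

lemma Dterm_0s (m : ℕ) : Dterm q 0 (m + 1) = (1 + q ^ (m + 1)) * Dterm q 0 m := by
  simp [Dterm, gbin_z, Finset.prod_Ioc_succ_top]; ring

lemma Dterm_ss (k m : ℕ) : Dterm q (k + 1) (m + 1) =
    (1 + q ^ (k + m + 2)) * Dterm q (k + 1) m + q ^ (k + m + 2) * Dterm q k m := by
  unfold Dterm
  rcases lt_trichotomy m k with h | h | h
  · rw [gbin_lt q _ (k + 1) (by omega), gbin_lt q m k h, gbin_lt q m (k + 1) (by omega)]; ring
  · subst h
    rw [gbin_ss, gbin_lt q m (m + 1) (by omega)]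
    simp; ring
  · obtain ⟨d, rfl⟩ : ∃ d, m = k + 1 + d := ⟨m - k - 1, by omega⟩
    have h1 : ∏ i ∈ Ioc (k + 1) (k + 1 + d + 1), (1 + q ^ i)
        = (∏ i ∈ Ioc (k + 1) (k + 1 + d), (1 + q ^ i)) * (1 + q ^ (k + 1 + d + 1)) :=
      prod_Ioc_succ_top (by omega) _
    have h2 : ∏ i ∈ Ioc k (k + 1 + d), (1 + q ^ i)
        = (1 + q ^ (k + 1)) * ∏ i ∈ Ioc (k + 1) (k + 1 + d), (1 + q ^ i) := by
      rw [← prod_Ioc_consecutive _ (show k ≤ k + 1 by omega) (show k + 1 ≤ k + 1 + d by omega)]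
      simp
    have p1 := gbin_ss q (k + 1 + d) k
    have p2 := gbin_pascal q (k + 1 + d) k (d + 1) (by omega)
    rw [h1, h2]
    generalize ∏ i ∈ Ioc (k + 1) (k + 1 + d), (1 + q ^ i) = W
    linear_combination q ^ ((k + 1) * (k + 1 + 1)) * W * p2
      + q ^ ((k + 1) * (k + 1 + 1)) * W * q ^ (k + 1 + d + 1) * p1

end

lemma qPhat_eq {R : Type*} [CommRing R] (q : R) (n : ℕ) :
    aeval q (qPhat (n + 1)) = ∑ x ∈ antidiagonal n, Dterm q x.1 x.2 := by
  induction n using Nat.strong_induction_on with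
  | _ n ih =>
    rcases n with _ | n
    · simp [qPhat, Dterm, gbin_z]
    · rw [qPhat]
      rcases n with _ | n
      · have := ih 0 (by omega)
        simp [qPhat, Finset.Nat.antidiagonal_succ, Dterm, gbin_z, gbin_zs]
      · have h1 := ih (n + 1) (by omega)
        have h2 := ih n (by omega)
        simp only [map_add, map_mul, map_pow, aeval_X, map_one]
        have hA := Finset.Nat.sum_antidiagonal_succ (n := n + 1) (f := fun x => Dterm q x.1 x.2)
        have hA' := Finset.Nat.sum_antidiagonal_succ' (n := n)
          (f := fun x => Dterm q (x.1 + 1) x.2)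
        have hB := Finset.Nat.sum_antidiagonal_succ (n := n) (f := fun x => Dterm q x.1 x.2)
        rw [h1, h2, hA, hA', hB]
        simp only [Dterm_s0, zero_add, Dterm_0s]
        have : ∀ x ∈ antidiagonal n, Dterm q (x.1 + 1) (x.2 + 1) =
            (1 + q ^ (n + 2)) * Dterm q (x.1 + 1) x.2 + q ^ (n + 2) * Dterm q x.1 x.2 := by
          intro x hx
          rw [Dterm_ss, mem_antidiagonal.1 hx]
        rw [sum_congr rfl this, sum_add_distrib, ← mul_sum, ← mul_sum]
        ring

lemma prod_one {K : Type*} [Field K] [CharZero K] (q : K) (p : ℕ) (h : IsPrimitiveRoot q p)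
    (hodd : Odd p) : ∏ i ∈ Ioc 0 (p - 1), (1 + q ^ i) = 1 := by
  classical
  have hp : 0 < p := hodd.pos
  obtain ⟨n, rfl⟩ : ∃ n, p = n + 1 := ⟨p - 1, by omega⟩
  have h1 := X_pow_sub_one_eq_prod hp h
  have h2 := congrArg (eval (-1 : K)) h1
  simp only [eval_sub, eval_pow, eval_X, eval_one, eval_prod, eval_C, hodd.neg_one_pow] at h2
  have h3 : nthRootsFinset (n + 1) (1 : K) = (range (n + 1)).image (fun i => q ^ i) := by
    ext x
    simp only [mem_nthRootsFinset hp, mem_image, mem_range]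
    constructor
    · intro hx; exact h.eq_pow_of_pow_eq_one hx
    · rintro ⟨i, _, rfl⟩; rw [← pow_mul, mul_comm, pow_mul, h.pow_eq_one, one_pow]
  rw [h3, prod_image (fun i hi j hj hij => h.pow_inj (by simpa using hi) (by simpa using hj) hij)]
    at h2
  have h4 : ∏ i ∈ range (n + 1), (-1 - q ^ i) = - ∏ i ∈ range (n + 1), (1 + q ^ i) := by
    have : ∀ i ∈ range (n + 1), (-1 - q ^ i) = (-1) * (1 + q ^ i) := fun i _ => by ring
    rw [prod_congr rfl this, prod_mul_distrib, prod_const, card_range, hodd.neg_one_pow]; ring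
  rw [h4, prod_range_succ'] at h2
  have h5 : ∏ i ∈ Ioc 0 n, (1 + q ^ i) = ∏ i ∈ range n, (1 + q ^ (i + 1)) := by
    rw [range_eq_Ico, prod_Ico_add' (fun i => 1 + q ^ i) 0 n 1]
    rfl
  simp only [Nat.add_sub_cancel]
  rw [h5]
  have : (2 : K) ≠ 0 := two_ne_zero
  apply mul_right_cancel₀ this
  linear_combination h2

lemma key {K : Type*} [Field K] [CharZero K] (q : K) (M : ℕ) (h : IsPrimitiveRoot q (2 * M + 1))
    (k : ℕ) : k ≤ M → gbin q (2 * M - k) k * ∏ i ∈ Ioc k (2 * M - k), (1 + q ^ i)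
      = gbin (q ^ 2) M k := by
  induction k with
  | zero =>
    intro _
    have := prod_one q _ h ⟨M, rfl⟩
    simpa [gbin_z] using this
  | succ k ih =>
    intro hk
    have ih := ih (by omega)
    obtain ⟨e, rfl⟩ : ∃ e, M = k + (e + 1) := ⟨M - k - 1, by omega⟩
    rw [show 2 * (k + (e + 1)) - k = k + (2 * e + 1) + 1 by omega] at ih
    rw [show 2 * (k + (e + 1)) - (k + 1) = k + (2 * e + 1) by omega]
    have hne : 1 - q ^ (2 * (k + 1)) ≠ 0 := by
      intro h0
      exact h.pow_ne_one_of_pos_of_lt (l := 2 * (k + 1)) (by omega) (by omega)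
        (sub_eq_zero.1 h0).symm
    have hq := h.pow_eq_one
    have r1 := gbin_ratio2 q k (2 * e + 1)
    have r2 := gbin_ratio q k (2 * e + 1)
    have r3 := gbin_ratio (q ^ 2) k (e + 1)
    have hP : ∏ i ∈ Ioc k (k + (2 * e + 1) + 1), (1 + q ^ i)
        = (1 + q ^ (k + 1)) * (∏ i ∈ Ioc (k + 1) (k + (2 * e + 1)), (1 + q ^ i))
          * (1 + q ^ (k + (2 * e + 1) + 1)) := by
      rw [prod_Ioc_succ_top (by omega),
        ← prod_Ioc_consecutive _ (show k ≤ k + 1 by omega) (show k + 1 ≤ k + (2 * e + 1) by omega)]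
      simp
    rw [hP] at ih
    generalize ∏ i ∈ Ioc (k + 1) (k + (2 * e + 1)), (1 + q ^ i) = W at *
    generalize gbin q (k + (2 * e + 1)) (k + 1) = g' at *
    generalize gbin q (k + (2 * e + 1)) k = hh at *
    generalize gbin q (k + (2 * e + 1) + 1) k = g at *
    generalize gbin (q ^ 2) (k + (e + 1)) (k + 1) = G' at *
    generalize gbin (q ^ 2) (k + (e + 1)) k = G at *
    have ea : q ^ (k + (2 * e + 1) + 1) = q ^ (k + 1) * q ^ (2 * e + 1) := by ring
    have eb : (q ^ 2) ^ (k + 1) = (q ^ (k + 1)) ^ 2 := by ring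
    have ec : (q ^ 2) ^ (e + 1) = q * q ^ (2 * e + 1) := by ring
    have ed : q ^ (2 * e + 1 + 1) = q * q ^ (2 * e + 1) := by ring
    have ee : q ^ (2 * (k + 1)) = (q ^ (k + 1)) ^ 2 := by ring
    have ef : q ^ (2 * (k + (e + 1)) + 1) = (q ^ (k + 1)) ^ 2 * q ^ (2 * e + 1) := by ring
    rw [ea] at ih r1
    rw [eb, ec] at r3
    rw [ed] at r1
    rw [ee] at hne
    rw [ef] at hq
    generalize q ^ (k + 1) = a at *
    generalize q ^ (2 * e + 1) = b at *
    apply mul_right_cancel₀ hne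
    linear_combination (1 + a) * W * r2 - r3 + (1 - q * b) * ih - (1 + a) * (1 + a * b) * W * r1
      + hh * (1 + a) * W * b * hq

lemma qPhat_root {K : Type*} [Field K] [CharZero K] (q : K) (M : ℕ)
    (h : IsPrimitiveRoot q (2 * M + 1)) :
    aeval q (qPhat (2 * M + 1)) = ∏ i ∈ range M, (1 + q ^ (2 * (i + 1))) := by
  have h1 := gbin_thm q M 1
  simp only [one_pow, mul_one, one_mul] at h1
  rw [qPhat_eq, Finset.Nat.sum_antidiagonal_eq_sum_range_succ (fun a b => Dterm q a b), ← h1]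
  have : range (M + 1) ⊆ range (2 * M).succ := by
    intro x; simp only [mem_range]; omega
  rw [← sum_subset this]
  · refine sum_congr rfl fun k hk => ?_
    rw [Dterm, mul_assoc, key q M h k (by simp at hk; omega)]
  · intro k _ hk
    simp only [mem_range] at hk
    rw [Dterm, gbin_lt q _ k (by omega)]; ring

lemma prod_sq {K : Type*} [Field K] [CharZero K] (q : K) (M T : ℕ) (hT : M * (M + 1) = 2 * T)
    (h : IsPrimitiveRoot q (2 * M + 1)) :
    (∏ i ∈ range M, (1 + q ^ (2 * (i + 1)))) ^ 2 = (q ^ T) ^ 2 := by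
  have h1 := prod_one q _ h ⟨M, rfl⟩
  simp only [Nat.add_sub_cancel] at h1
  have h2 : ∀ N : ℕ, ∏ i ∈ Ioc 0 (2 * N), (1 + q ^ i)
      = (∏ i ∈ range N, (1 + q ^ (2 * (i + 1)))) * ∏ i ∈ range N, (1 + q ^ (2 * i + 1)) := by
    intro N
    induction N with
    | zero => simp
    | succ N ih =>
      rw [show 2 * (N + 1) = 2 * N + 1 + 1 by ring, prod_Ioc_succ_top (by omega),
        prod_Ioc_succ_top (by omega), ih, prod_range_succ, prod_range_succ]
      ring
  have h3 : ∏ i ∈ range M, (1 + q ^ (2 * (i + 1)))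
      = (∏ i ∈ range M, q ^ (2 * (i + 1))) * ∏ i ∈ range M, (1 + q ^ (2 * i + 1)) := by
    rw [← prod_range_reflect (fun i => 1 + q ^ (2 * i + 1)), ← prod_mul_distrib]
    refine prod_congr rfl fun i hi => ?_
    have hi := mem_range.1 hi
    rw [mul_add (q ^ _), mul_one (q ^ _), ← pow_add,
      show 2 * (i + 1) + (2 * (M - 1 - i) + 1) = 2 * M + 1 by omega, h.pow_eq_one, add_comm]
  have h4 : ∀ N : ℕ, ∏ i ∈ range N, q ^ (2 * (i + 1)) = q ^ (N * (N + 1)) := by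
    intro N
    induction N with
    | zero => simp
    | succ N ih => rw [prod_range_succ, ih]; ring
  rw [h2] at h1
  rw [h4, hT] at h3
  rw [sq]
  nth_rewrite 2 [h3]
  rw [← pow_mul, mul_comm T 2]
  linear_combination q ^ (2 * T) * h1

lemma dvd_of_root (p : ℕ) (hp : p.Prime) (q : ℂ) (h : IsPrimitiveRoot q p) (f : ℤ[X])
    (hf : aeval q f = 0) : qbracket p ∣ f := by
  have := Fact.mk hp
  have h1 : qbracket p = cyclotomic p ℤ := (cyclotomic_prime ℤ p).symm
  rw [h1, cyclotomic_eq_minpoly h hp.pos]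
  exact minpoly.isIntegrallyClosed_dvd (h.isIntegral hp.pos) hf

/-- For an odd prime p, (p²−1)/8 is an integer and
P̂_p(q) ≡ (2/p)·q^((p²−1)/8) (mod [p]_q) in ℤ[q]. -/
theorem qPellHat_prime_congr (p : ℕ) (hp : p.Prime) (hodd : Odd p) :
    8 ∣ p ^ 2 - 1 ∧
      qbracket p ∣ qPhat p - C (@legendreSym p ⟨hp⟩ 2) * X ^ ((p ^ 2 - 1) / 8) := by
  have : Fact p.Prime := ⟨hp⟩
  obtain ⟨M, rfl⟩ := hodd
  obtain ⟨T, hT⟩ : ∃ T, M * (M + 1) = 2 * T := (Nat.even_mul_succ_self M).two_dvd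
  have h8 : (2 * M + 1) ^ 2 - 1 = 8 * T := by
    have : (2 * M + 1) ^ 2 = 8 * T + 1 := by linear_combination 4 * hT
    omega
  refine ⟨⟨T, h8⟩, ?_⟩
  rw [h8, Nat.mul_div_cancel_left _ (by norm_num)]
  have hz : IsPrimitiveRoot (Complex.exp (2 * Real.pi * Complex.I / ((2 * M + 1 : ℕ) : ℂ)))
    (2 * M + 1) := Complex.isPrimitiveRoot_exp _ (by omega)
  generalize Complex.exp (2 * Real.pi * Complex.I / ((2 * M + 1 : ℕ) : ℂ)) = q at hz
  obtain ⟨s, hs, hE⟩ : ∃ s : ℤ, (s = 1 ∨ s = -1) ∧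
      ∏ i ∈ range M, (1 + q ^ (2 * (i + 1))) = (s : ℂ) * q ^ T := by
    rcases sq_eq_sq_iff_eq_or_eq_neg.1 (prod_sq q M T hT hz) with h | h
    · exact ⟨1, Or.inl rfl, by simpa using h⟩
    · exact ⟨-1, Or.inr rfl, by simpa using h⟩
  have hd : qbracket (2 * M + 1) ∣ (∏ i ∈ range M, (1 + X ^ (2 * (i + 1))) - C s * X ^ T) := by
    apply dvd_of_root _ hp q hz
    simp [map_prod, hE]
  have hd1 : ((2 * M + 1 : ℕ) : ℤ) ∣ 2 ^ M - s := by
    have := eval_dvd (x := (1 : ℤ)) hd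
    simpa [qbracket, eval_finsetSum, eval_prod, one_add_one_eq_two] using this
  have hleg : ((legendreSym (2 * M + 1) 2 : ℤ) : ZMod (2 * M + 1)) = 2 ^ M := by
    rw [legendreSym.eq_pow]
    congr 1
    omega
  have hl2 : ((2 * M + 1 : ℕ) : ℤ) ∣ 2 ^ M - legendreSym (2 * M + 1) 2 := by
    rw [← ZMod.intCast_zmod_eq_zero_iff_dvd]
    push_cast
    rw [hleg]; simp
  have hM : 1 ≤ M := by
    rcases M with _ | M
    · exact absurd hp (by norm_num)
    · omega
  have h20 : ((2 : ℤ) : ZMod (2 * M + 1)) ≠ 0 := by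
    rw [Ne, ZMod.intCast_zmod_eq_zero_iff_dvd]
    intro hh
    have := Int.le_of_dvd (by norm_num) hh
    push_cast at this
    omega
  have hpm := legendreSym.eq_one_or_neg_one (2 * M + 1) h20
  have hsl : legendreSym (2 * M + 1) 2 = s := by
    have h3 := dvd_sub hd1 hl2
    rw [show (2 ^ M - s - (2 ^ M - legendreSym (2 * M + 1) 2) : ℤ)
      = legendreSym (2 * M + 1) 2 - s by ring] at h3
    generalize legendreSym (2 * M + 1) 2 = l at *
    push_cast at h3
    rcases hs with rfl | rfl <;> rcases hpm with rfl | rfl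
    · rfl
    · have := Int.le_of_dvd (by norm_num) ((dvd_neg).2 h3); omega
    · have := Int.le_of_dvd (by norm_num) h3; omega
    · rfl
  apply dvd_of_root _ hp q hz
  rw [hsl, map_sub, qPhat_root q M hz, hE]
  simp
end

section
/- Let p be an odd prime. Then P_{p+1}(q) − P_p(q) ≡ 1 (mod [p]_q) in ℤ[q]. -/
open Polynomial

namespace QPell

/-- product of linear factors -/
noncomputable def L (a : ℕ → ℂ) (n : ℕ) : ℂ[X] := ∏ i ∈ Finset.range n, (1 + C (a i) * X)

lemma L_zero (a : ℕ → ℂ) : L a 0 = 1 := by simp [L]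

lemma L_succ (a : ℕ → ℂ) (n : ℕ) : L a (n + 1) = L a n * (1 + C (a n) * X) := by
  simp [L, Finset.prod_range_succ]

lemma L_succ' (a : ℕ → ℂ) (n : ℕ) :
    L a (n + 1) = L (fun i => a (i + 1)) n * (1 + C (a 0) * X) := by
  simp [L, Finset.prod_range_succ']

lemma L_coeff_succ (a : ℕ → ℂ) (n m : ℕ) :
    (L a (n + 1)).coeff (m + 1) = (L a n).coeff (m + 1) + a n * (L a n).coeff m := by
  rw [L_succ, mul_add, mul_one, coeff_add, mul_left_comm, coeff_C_mul, coeff_mul_X]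

lemma L_coeff_zero (a : ℕ → ℂ) (n : ℕ) : (L a n).coeff 0 = 1 := by
  induction n with
  | zero => simp [L_zero]
  | succ n ih => rw [L_succ]; simp [mul_coeff_zero, ih]

lemma L_coeff_big (a : ℕ → ℂ) (n : ℕ) : ∀ m, n < m → (L a n).coeff m = 0 := by
  induction n with
  | zero => intro m hm; rw [L_zero, coeff_one, if_neg (by omega)]
  | succ n ih =>
    intro m hm
    obtain ⟨m, rfl⟩ : ∃ k, m = k + 1 := ⟨m - 1, by omega⟩
    rw [L_coeff_succ, ih _ (by omega), ih _ (by omega)]; simp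

lemma L_reverse (a b : ℕ → ℂ) (n : ℕ) (hab : ∀ i < n, a i * b i = -1) :
    ∀ m l, m + l = n →
      (L a n).coeff m = (-1) ^ l * (∏ i ∈ Finset.range n, a i) * (L b n).coeff l := by
  induction n with
  | zero =>
    intro m l h
    obtain ⟨rfl, rfl⟩ : m = 0 ∧ l = 0 := by omega
    simp [L_zero]
  | succ n ih =>
    intro m l h
    have ih := ih (fun i hi => hab i (by omega))
    have hn := hab n (by omega)
    rw [Finset.prod_range_succ]
    rcases m with _ | m
    · obtain rfl : l = n + 1 := by omega
      have := ih 0 n (by omega)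
      rw [L_coeff_zero] at this ⊢
      rw [L_coeff_succ, L_coeff_big b n (n + 1) (by omega), pow_succ]
      linear_combination this + (-1) ^ n * (∏ i ∈ Finset.range n, a i) * (L b n).coeff n * hn
    · rcases l with _ | l
      · obtain rfl : m = n := by omega
        have := ih m 0 (by omega)
        rw [L_coeff_zero] at this ⊢
        rw [L_coeff_succ, L_coeff_big a m (m + 1) (by omega)]
        linear_combination a m * this
      · have h1 := ih (m + 1) l (by omega)
        have h2 := ih m (l + 1) (by omega)
        rw [L_coeff_succ, L_coeff_succ, h1, h2, pow_succ]
        linear_combination (-1) ^ l * (∏ i ∈ Finset.range n, a i) * (L b n).coeff l * hn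

lemma L_reflect (a : ℕ → ℂ) (n : ℕ) : L (fun i => a (n - 1 - i)) n = L a n := by
  unfold L
  exact Finset.prod_range_reflect (fun i => 1 + C (a i) * X) n

/-- coefficients -/
noncomputable def a (q : ℂ) (k i : ℕ) : ℂ := if i < k then q ^ i else -q ^ (i + 1)

/-- triangular power -/
noncomputable def c (q : ℂ) (k : ℕ) : ℂ := ∏ i ∈ Finset.range k, q ^ (i + 1)

lemma c_p {q : ℂ} {p : ℕ} (hq : q ^ p = 1) (hodd : Odd p) : c q p = 1 := by
  unfold c
  rw [Finset.prod_pow_eq_pow_sum]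
  have h : ∑ i ∈ Finset.range p, (i + 1) = p * ((p + 1) / 2) := by
    have h1 := Finset.sum_range_id_mul_two (p + 1)
    rw [Finset.sum_range_succ'] at h1
    obtain ⟨m, rfl⟩ := hodd
    have : (2 * m + 1 + 1) / 2 = m + 1 := by omega
    rw [this]
    rw [Nat.add_sub_cancel] at h1
    nlinarith
  rw [h, pow_mul, hq, one_pow]

lemma D_antisymm {q : ℂ} {p k l : ℕ} (hq : q ^ p = 1) (hodd : Odd p) (hkl : k + l = p) :
    c q k * (L (a q k) p).coeff l + c q l * (L (a q l) p).coeff k = 0 := by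
  have h1 := L_reverse (a q k) (fun i => a q l (p - 1 - i)) p (by
    intro i hi
    unfold a
    by_cases h : i < k
    · rw [if_pos h, if_neg (by omega), mul_neg, ← pow_add,
        show i + (p - 1 - i + 1) = p by omega, hq]
    · rw [if_neg h, if_pos (by omega), neg_mul, ← pow_add,
        show i + 1 + (p - 1 - i) = p by omega, hq]) l k (by omega)
  rw [L_reflect] at h1
  have h2 : ∏ i ∈ Finset.range p, a q k i =
      (∏ i ∈ Finset.range k, q ^ i) * ((-1) ^ l * ∏ i ∈ Finset.range l, q ^ (k + i + 1)) := by
    rw [← hkl, Finset.prod_range_add]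
    congr 1
    · exact Finset.prod_congr rfl fun i hi => by simp [a, Finset.mem_range.1 hi]
    · conv_rhs => rw [← Finset.card_range l, ← Finset.prod_const, Finset.card_range,
        ← Finset.prod_mul_distrib]
      exact Finset.prod_congr rfl fun i hi => by simp [a]
  have h3 : c q k * ∏ i ∈ Finset.range l, q ^ (k + i + 1) = 1 := by
    rw [← c_p hq hodd, ← hkl, c, c, Finset.prod_range_add]
  have h4 : c q l * ∏ i ∈ Finset.range k, q ^ (l + i + 1) = 1 := by
    rw [← c_p hq hodd, ← hkl, add_comm k l, c, c, Finset.prod_range_add]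
  have h5 : (∏ i ∈ Finset.range k, q ^ i) * ∏ i ∈ Finset.range k, q ^ (l + i + 1) = 1 := by
    rw [← Finset.prod_range_reflect (fun i => q ^ i), ← Finset.prod_mul_distrib]
    refine Finset.prod_eq_one fun i hi => ?_
    have := Finset.mem_range.1 hi
    rw [← pow_add, show k - 1 - i + (l + i + 1) = p by omega, hq]
  have h6 : c q l = ∏ i ∈ Finset.range k, q ^ i := by
    linear_combination (-c q l) * h5 + (∏ i ∈ Finset.range k, q ^ i) * h4
  have h7 : (-1 : ℂ) ^ k * (-1) ^ l = -1 := by rw [← pow_add, hkl, hodd.neg_one_pow]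
  rw [h1, h2, ← h6]
  linear_combination (c q l * (L (a q l) p).coeff k) * ((-1 : ℂ) ^ k * (-1) ^ l * h3 + h7)

/-- summand -/
noncomputable def M (q : ℂ) (p k : ℕ) : ℂ[X] := C (c q k) * X ^ (k + 1) * L (a q k) p

/-- generating polynomial -/
noncomputable def N (q : ℂ) (n : ℕ) : ℂ[X] :=
  ∑ k ∈ Finset.range (n + 1), M q n k

lemma M_one {q : ℂ} {n k : ℕ} (hq : q ^ (n + 1) = 1) (hk : k ≤ n) :
    (1 - X) * M q n k = M q (n + 1) k := by
  have : a q k n = -1 := by unfold a; rw [if_neg (by omega), hq]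
  rw [M, M, L_succ, this]
  simp only [map_neg, map_one]
  ring

lemma M_shift (q : ℂ) (n k : ℕ) :
    X * (1 + X) * (M q n k).comp (C q * X) = M q (n + 1) (k + 1) := by
  have h0 : a q (k + 1) 0 = 1 := by simp [a]
  have h1 : (L (a q k) n).comp (C q * X) = L (fun i => a q (k + 1) (i + 1)) n := by
    unfold L
    rw [prod_comp]
    refine Finset.prod_congr rfl fun i _ => ?_
    have : a q (k + 1) (i + 1) = a q k i * q := by
      unfold a
      by_cases h : i < k
      · rw [if_pos h, if_pos (by omega), pow_succ]
      · rw [if_neg h, if_neg (by omega), pow_succ]; ring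
    simp [this, mul_assoc]
  have h2 : c q (k + 1) = c q k * q ^ (k + 1) := by simp [c, Finset.prod_range_succ]
  rw [M, M, L_succ', h0, h2]
  simp only [mul_comp, C_comp, X_pow_comp, h1, map_mul, map_pow, map_one, mul_pow]
  ring

lemma N_eq {q : ℂ} {n : ℕ} (hq : q ^ (n + 1) = 1) :
    (1 - X) * N q n + M q (n + 1) (n + 1) =
      M q (n + 1) 0 + X * (1 + X) * (N q n).comp (C q * X) := by
  have e1 : (1 - X) * N q n = ∑ k ∈ Finset.range (n + 1), M q (n + 1) k := by
    rw [N, Finset.mul_sum]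
    exact Finset.sum_congr rfl fun k hk => M_one hq (by have := Finset.mem_range.1 hk; omega)
  have e2 : X * (1 + X) * (N q n).comp (C q * X) =
      ∑ k ∈ Finset.range (n + 1), M q (n + 1) (k + 1) := by
    rw [N, Polynomial.sum_comp, Finset.mul_sum]
    exact Finset.sum_congr rfl fun k _ => M_shift q n k
  rw [e1, e2, ← Finset.sum_range_succ, Finset.sum_range_succ', add_comm]

lemma M_zero {q : ℂ} {p : ℕ} (hp : 0 < p) (hq : IsPrimitiveRoot q p) :
    M q p 0 = X * (1 - X ^ p) := by
  have h1 := X_pow_sub_C_eq_prod (hq.map_of_injective (f := (C : ℂ →+* ℂ[X])) C_injective)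
    (α := C q * X) (a := X ^ p) hp (by rw [mul_pow, ← map_pow, hq.pow_eq_one]; simp)
  have h2 := congrArg (eval 1) h1
  simp only [eval_sub, eval_pow, eval_X, eval_C, eval_prod, one_pow] at h2
  rw [M, h2]
  simp only [c, L, a, Finset.range_zero, Finset.prod_empty, map_one, one_mul, zero_add, pow_one]
  congr 1
  refine Finset.prod_congr rfl fun i _ => ?_
  simp [pow_succ]
  ring

lemma M_coeff_low (q : ℂ) (p k m : ℕ) (h : m < k + 1) : (M q p k).coeff m = 0 := by
  rw [M, mul_assoc, coeff_C_mul, coeff_X_pow_mul', if_neg (by omega), mul_zero]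

lemma M_coeff (q : ℂ) (p k l : ℕ) :
    (M q p k).coeff (l + (k + 1)) = c q k * (L (a q k) p).coeff l := by
  rw [M, mul_assoc, coeff_C_mul, coeff_X_pow_mul]

lemma N_rec {q : ℂ} {n : ℕ} (hq : IsPrimitiveRoot q (n + 1)) (m : ℕ) :
    (N q n).coeff (m + 2) - (N q n).coeff (m + 1) + (M q (n + 1) (n + 1)).coeff (m + 2) =
      (X * (1 - X ^ (n + 1)) : ℂ[X]).coeff (m + 2) + (N q n).coeff (m + 1) * q ^ (m + 1)
        + (N q n).coeff m * q ^ m := by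
  have h := congrArg (fun f => coeff f (m + 2)) (N_eq hq.pow_eq_one)
  simp only [M_zero n.succ_pos hq] at h
  have e : X * (1 + X) * (N q n).comp (C q * X) =
    X * ((N q n).comp (C q * X) + X * (N q n).comp (C q * X)) := by ring
  rw [e] at h
  rw [sub_mul, one_mul] at h
  simp only [coeff_add, coeff_sub, coeff_X_mul, comp_C_mul_X_coeff] at h ⊢
  linear_combination h

/-- evaluated sequence -/
noncomputable def P (q : ℂ) (n : ℕ) : ℂ := aeval q (qP n)

lemma P_rec (q : ℂ) (n : ℕ) : P q (n + 2) = (1 + q ^ (n + 1)) * P q (n + 1) + q ^ n * P q n := by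
  simp [P, qP]

lemma XX_coeff (n m : ℕ) : (X * (1 - X ^ (n + 1)) : ℂ[X]).coeff (m + 2) =
    if m = n then -1 else 0 := by
  rw [show m + 2 = (m + 1) + 1 by ring, coeff_X_mul, coeff_sub, coeff_one, coeff_X_pow]
  by_cases h : m = n <;> simp [h]

lemma N_coeff {q : ℂ} {n : ℕ} (hq : IsPrimitiveRoot q (n + 1)) :
    ∀ m, m ≤ n → (N q n).coeff m = P q m ∧ (N q n).coeff (m + 1) = P q (m + 1) := by
  intro m
  induction m with
  | zero =>
    intro _
    constructor
    · rw [N, finsetSum_coeff, Finset.sum_eq_zero]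
      · simp [P, qP]
      · intro k _; exact M_coeff_low _ _ _ _ (by omega)
    · rw [N, finsetSum_coeff, Finset.sum_range_succ', Finset.sum_eq_zero]
      · have := M_coeff q n 0 0
        simp only [zero_add] at this ⊢
        rw [this, L_coeff_zero]
        simp [P, qP, c]
      · intro k _; exact M_coeff_low _ _ _ _ (by omega)
  | succ m ih =>
    intro hm
    obtain ⟨i1, i2⟩ := ih (by omega)
    refine ⟨i2, ?_⟩
    have h := N_rec hq m
    rw [M_coeff_low _ _ _ _ (by omega), XX_coeff, if_neg (by omega), i1, i2] at h
    rw [show m + 1 + 1 = m + 2 by ring, P_rec]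
    linear_combination h

lemma main {q : ℂ} {n : ℕ} (hq : IsPrimitiveRoot q (n + 1)) (hodd : Odd (n + 1)) :
    P q (n + 2) - P q (n + 1) = 1 := by
  have h := N_rec hq n
  obtain ⟨i1, i2⟩ := N_coeff hq n le_rfl
  have hM := M_coeff q (n + 1) (n + 1) 0
  rw [L_coeff_zero, c_p hq.pow_eq_one hodd, show 0 + (n + 1 + 1) = n + 2 by ring] at hM
  rw [XX_coeff, if_pos rfl, i1, i2, hM] at h
  have e1 : (1 - X) * N q n = ∑ k ∈ Finset.range (n + 1), M q (n + 1) k := by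
    rw [N, Finset.mul_sum]
    exact Finset.sum_congr rfl fun k hk =>
      M_one hq.pow_eq_one (by have := Finset.mem_range.1 hk; omega)
  have e2 := congrArg (fun f => coeff f (n + 2)) e1
  rw [sub_mul, one_mul, Finset.sum_range_succ', M_zero n.succ_pos hq] at e2
  simp only [coeff_add, coeff_sub, coeff_X_mul, finsetSum_coeff] at e2
  have e3 : ∑ k ∈ Finset.range n, (M q (n + 1) (k + 1)).coeff (n + 2) = 0 := by
    refine Finset.sum_involution (fun k _ => n - 1 - k) ?_ ?_ ?_ ?_
    · intro k hk
      have hk := Finset.mem_range.1 hk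
      have f1 := M_coeff q (n + 1) (k + 1) (n - 1 - k + 1)
      have f2 := M_coeff q (n + 1) (n - 1 - k + 1) (k + 1)
      rw [show n - 1 - k + 1 + (k + 1 + 1) = n + 2 by omega] at f1
      rw [show k + 1 + (n - 1 - k + 1 + 1) = n + 2 by omega] at f2
      rw [f1, f2]
      exact D_antisymm hq.pow_eq_one hodd (by omega)
    · intro k hk _ h
      have hk := Finset.mem_range.1 hk
      obtain ⟨m, hm⟩ := hodd
      omega
    · intro k hk
      have hk := Finset.mem_range.1 hk
      exact Finset.mem_range.2 (by omega)
    · intro k hk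
      have hk := Finset.mem_range.1 hk
      omega
  have e4 := XX_coeff n n
  rw [coeff_X_mul, if_pos rfl, coeff_sub] at e4
  rw [e3, e4, i2] at e2
  rw [P_rec]
  linear_combination e2 - h

end QPell

/-- For an odd prime p, P_{p+1}(q) − P_p(q) ≡ 1 (mod [p]_q) in ℤ[q]. -/
theorem qPell_succ_sub_congr (p : ℕ) (hp : p.Prime) (hodd : Odd p) :
    qbracket p ∣ qP (p + 1) - qP p - 1 := by
  obtain ⟨n, rfl⟩ : ∃ n, p = n + 1 := ⟨p - 1, by have := hp.pos; omega⟩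
  have : Fact (n + 1).Prime := ⟨hp⟩
  have hq := Complex.isPrimitiveRoot_exp (n + 1) n.succ_ne_zero
  have h := QPell.main hq hodd
  have e : qbracket (n + 1) = cyclotomic (n + 1) ℤ := by
    rw [cyclotomic_prime, qbracket]
  rw [e, cyclotomic_eq_minpoly hq n.succ_pos]
  refine minpoly.isIntegrallyClosed_dvd (hq.isIntegral n.succ_pos) ?_
  rw [map_sub, map_sub, map_one]
  unfold QPell.P at h
  rw [h, sub_self]
end

section
/- Let p be an odd prime. Then P̂_{p+1}(q) − P̂_p(q) ≡ 1 (mod [p]_q) in ℤ[q]. -/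
open Polynomial

section aux
open Finset

theorem qp_iter {R : Type*} [CommRing R] (u v H : ℕ → R)
    (h : ∀ k, u k * H k = u k + v k * H (k+1)) (k : ℕ) :
    (∏ i ∈ range k, u i) * H 0 = ∑ m ∈ range k, (∏ i ∈ range m, v i) * (∏ i ∈ Ico m k, u i)
      + (∏ i ∈ range k, v i) * H k := by
  induction k with
  | zero => simp
  | succ k ih =>
    rw [prod_range_succ, mul_right_comm, ih, sum_range_succ, prod_range_succ, add_mul, sum_mul]
    have : ∑ m ∈ range k, (∏ i ∈ range m, v i) * (∏ i ∈ Ico m (k+1), u i)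
        = ∑ m ∈ range k, (∏ i ∈ range m, v i) * (∏ i ∈ Ico m k, u i) * u k := by
      apply sum_congr rfl
      intro m hm
      rw [prod_Ico_succ_top (mem_range.1 hm).le, mul_assoc]
    rw [this]
    simp only [Nat.Ico_succ_singleton, prod_singleton]
    linear_combination (∏ i ∈ range k, v i) * h k

theorem qp_reflect {R : Type*} [CommRing R] (a : ℕ → R) (n : ℕ) :
    (∏ i ∈ range n, (1 + C (a i) * X)).natDegree ≤ n ∧
    reflect n (∏ i ∈ range n, (1 + C (a i) * X)) = ∏ i ∈ range n, (X + C (a i)) := by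
  induction n with
  | zero => simp
  | succ n ih =>
    have h1 : (1 + C (a n) * X : R[X]).natDegree ≤ 1 := by compute_degree
    constructor
    · rw [prod_range_succ]
      exact natDegree_mul_le_of_le ih.1 h1
    · rw [prod_range_succ, prod_range_succ, reflect_mul _ _ ih.1 h1, ih.2]
      congr 1
      rw [reflect_add, reflect_C_mul]
      have : reflect 1 (1 : R[X]) = X := by
        simpa using reflect_monomial (R := R) 1 0
      have h2 : reflect 1 (X : R[X]) = 1 := by
        simpa using reflect_monomial (R := R) 1 1
      rw [this, h2, mul_one]

/-- the polynomial B_k -/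
noncomputable def qpB (z : ℂ) (p k : ℕ) : ℂ[X] :=
  (∏ i ∈ range k, (1 + C (z^i) * X)) * ∏ i ∈ range (p-k), (1 - C (z^(k+i)) * X)

theorem qp_prodpow (z : ℂ) (p : ℕ) (hodd : Odd p) (hz : z ^ p = 1) : ∏ i ∈ range p, z^i = 1 := by
  rw [prod_pow_eq_pow_sum]
  obtain ⟨m, rfl⟩ := hodd
  have : ∑ i ∈ range (2*m+1), i = (2*m+1) * m := by
    have := Finset.sum_range_id_mul_two (2*m+1)
    simp at this
    nlinarith
  rw [this, pow_mul, hz, one_pow]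

theorem qp_r (z : ℂ) (p k : ℕ) (hk : k ≤ p) (hodd : Odd p) (hz : z ^ p = 1) :
    ∏ i ∈ range (p-k), z^i = z^k * ∏ i ∈ range k, z^i := by
  have h := qp_prodpow z p hodd hz
  have h0 : z ≠ 0 := by
    rintro rfl
    rw [zero_pow hodd.pos.ne'] at hz; exact zero_ne_one hz
  obtain ⟨m, rfl⟩ := Nat.exists_eq_add_of_le' hk
  rw [Nat.add_sub_cancel]
  rw [prod_range_add, ← prod_range_reflect (fun i => z^(m+i))] at h
  have h3 : (∏ i ∈ range k, z^(m+(k-1-i))) * (z^k * ∏ i ∈ range k, z^i) = 1 := by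
    have : z^k = ∏ i ∈ range k, z := by simp
    rw [this, ← prod_mul_distrib, ← prod_mul_distrib]
    apply prod_eq_one
    intro i hi
    rw [mem_range] at hi
    rw [← pow_succ', ← pow_add, ← hz]
    congr 1; omega
  have h4 : (∏ i ∈ range k, z^(m+(k-1-i))) ≠ 0 := left_ne_zero_of_mul_eq_one h3
  apply mul_left_cancel₀ h4
  rw [h3, mul_comm, h]

theorem qp_rev (z : ℂ) (p k : ℕ) (hk : k ≤ p) (hodd : Odd p) (hz : z ^ p = 1) :
    reflect p (qpB z p k) = C ((-1)^(p-k)) * (qpB z p (p-k)).comp (C (-z) * X) := by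
  have h1 := qp_reflect (fun i => z^i) k
  have h2 := qp_reflect (fun i => -z^(k+i)) (p-k)
  have h := qp_prodpow z p hodd hz
  obtain ⟨m, rfl⟩ := Nat.exists_eq_add_of_le' hk
  simp only [Nat.add_sub_cancel, C_neg, neg_mul, ← sub_eq_add_neg] at h2
  have e : reflect (m+k) (qpB z (m+k) k) = (∏ i ∈ range k, (X + C (z^i))) * ∏ i ∈ range m, (X - C (z^(k+i))) := by
    rw [qpB, Nat.add_sub_cancel, add_comm, reflect_mul _ _ h1.1 h2.1, h1.2, h2.2]
  rw [e, qpB, Nat.add_sub_cancel, Nat.add_sub_cancel_left, mul_comp,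
    ← prod_range_reflect (fun i => (1 + C (z^i) * X)) m, ← prod_range_reflect (fun i => (1 - C (z^(m+i)) * X)) k]
  simp only [Polynomial.prod_comp, add_comp, sub_comp, mul_comp, one_comp, C_comp, X_comp]
  have e1 : ∏ i ∈ range k, (X + C (z^i)) = C (∏ i ∈ range k, z^i) *
      ∏ i ∈ range k, (1 - C (z^(m+(k-1-i))) * (C (-z) * X)) := by
    rw [map_prod, ← prod_mul_distrib]
    apply prod_congr rfl
    intro i hi
    rw [mem_range] at hi
    have : z^i * z^(m+(k-1-i)) * z = 1 := by
      rw [← pow_add, ← pow_succ, ← hz]; congr 1; omega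
    have := congrArg C this
    simp only [C_mul, C_1, C_neg] at this ⊢
    linear_combination (-X) * this
  have e2 : ∏ i ∈ range m, (X - C (z^(k+i))) = C ((-1)^m * ∏ i ∈ range m, z^(k+i)) *
      ∏ i ∈ range m, (1 + C (z^(m-1-i)) * (C (-z) * X)) := by
    have : (-1:ℂ)^m = ∏ i ∈ range m, (-1) := by simp
    rw [this, ← prod_mul_distrib, map_prod, ← prod_mul_distrib]
    apply prod_congr rfl
    intro i hi
    rw [mem_range] at hi
    have : z^(k+i) * z^(m-1-i) * z = 1 := by
      rw [← pow_add, ← pow_succ, ← hz]; congr 1; omega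
    have := congrArg C this
    simp only [C_mul, C_1, C_neg] at this ⊢
    linear_combination (-X) * this
  rw [add_comm m k, prod_range_add] at h
  have h' := congrArg C h
  rw [e1, e2]
  simp only [C_mul, C_1] at h' ⊢
  linear_combination (C ((-1)^m) * (∏ i ∈ range m, (1 + C (z^(m-1-i)) * (C (-z) * X))) *
      ∏ i ∈ range k, (1 - C (z^(m+(k-1-i))) * (C (-z) * X))) * h'

theorem qp_b (z : ℂ) (p k : ℕ) (hk : k ≤ p) (hodd : Odd p) (hz : z ^ p = 1) :
    (qpB z p k).coeff (p-k) = - z^k * (qpB z p (p-k)).coeff k := by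
  have h := congrArg (fun f => coeff f k) (qp_rev z p k hk hodd hz)
  simp only [coeff_reflect, coeff_C_mul, comp_C_mul_X_coeff, revAt_le hk] at h
  rw [h, neg_pow z k]
  have : (-1:ℂ)^(p-k) * (-1)^k = -1 := by
    rw [← pow_add, Nat.sub_add_cancel hk, hodd.neg_one_pow]
  linear_combination (z^k * (qpB z p (p-k)).coeff k) * this

theorem qp_sum (z : ℂ) (p : ℕ) (hodd : Odd p) (hz : z ^ p = 1) :
    ∑ k ∈ Ico 1 p, (∏ i ∈ range k, z^i) * (qpB z p k).coeff (p-k) = 0 := by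
  have h : ∑ k ∈ Ico 1 p, (∏ i ∈ range k, z^i) * (qpB z p k).coeff (p-k) =
      ∑ k ∈ Ico 1 p, - ((∏ i ∈ range k, z^i) * (qpB z p k).coeff (p-k)) := by
    apply sum_bij' (fun k _ => p-k) (fun k _ => p-k)
    · intro k hk; simp at hk ⊢; omega
    · intro k hk; simp at hk ⊢; omega
    · intro k hk; simp at hk ⊢; omega
    · intro k hk; simp at hk ⊢; omega
    · intro k hk
      have hk' : k ≤ p := by simp at hk; omega
      rw [qp_b z p k hk' hodd hz, qp_r z p k hk' hodd hz, Nat.sub_sub_self hk']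
      ring
  rw [sum_neg_distrib] at h
  exact self_eq_neg.1 h

theorem qp_prod_sub (z : ℂ) (p : ℕ) (hp : 0 < p) (hz : IsPrimitiveRoot z p) :
    ∏ i ∈ range p, (1 - C (z^i) * X) = 1 - (X:ℂ[X])^p := by
  have h := X_pow_sub_C_eq_prod hz hp (a := 1) (α := 1) (by simp)
  have h2 := (qp_reflect (fun i => -z^i) p).2
  simp only [C_neg, ← sub_eq_add_neg, neg_mul] at h2
  simp only [mul_one] at h
  rw [← h] at h2
  have h3 := congrArg (reflect p) h2
  have hinv : ∀ f : ℂ[X], reflect p (reflect p f) = f := by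
    intro f; ext n; simp
  rw [hinv, reflect_sub, reflect_C] at h3
  have := reflect_monomial (R := ℂ) p p
  rw [revAt_le le_rfl, Nat.sub_self, pow_zero] at this
  rw [h3, this]; simp

theorem qp_prod_add (z : ℂ) (p : ℕ) (hodd : Odd p) (hz : IsPrimitiveRoot z p) :
    ∏ i ∈ range p, (1 + C (z^i) * X) = 1 + (X:ℂ[X])^p := by
  have h := congrArg (fun f => f.comp (-X)) (qp_prod_sub z p hodd.pos hz)
  simpa [Polynomial.prod_comp, hodd.neg_pow, -map_pow] using h

noncomputable def qph (z : ℂ) : ℕ → ℂ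
  | 0 => 1
  | n+1 => aeval z (qPhat (n+1)) + aeval z (qPhat n)

theorem qph_rec (z : ℂ) (n : ℕ) : qph z (n+2) - qph z (n+1) =
    z^(n+1) * qph z (n+1) + z^n * qph z n := by
  cases n with
  | zero => simp [qph, qPhat]; ring
  | succ n => simp [qph, qPhat]; ring

theorem qp_H (z : ℂ) (k : ℕ) :
    (1 - PowerSeries.C (z^k) * PowerSeries.X) * PowerSeries.mk (fun n => qph z n * z^(k*n)) =
    (1 - PowerSeries.C (z^k) * PowerSeries.X) +
    (PowerSeries.C (z^k) * PowerSeries.X * (1 + PowerSeries.C (z^k) * PowerSeries.X)) *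
      PowerSeries.mk (fun n => qph z n * z^((k+1)*n)) := by
  ext n
  have e : ∀ f : PowerSeries ℂ, (PowerSeries.C (z^k) * PowerSeries.X * (1 + PowerSeries.C (z^k) * PowerSeries.X)) * f =
    PowerSeries.C (z^k) * (f * PowerSeries.X) + PowerSeries.C (z^k) * (PowerSeries.C (z^k) * (f * PowerSeries.X * PowerSeries.X)) := by
    intro f; ring
  have e' : ∀ f : PowerSeries ℂ, (1 - PowerSeries.C (z^k) * PowerSeries.X) * f =
    f - PowerSeries.C (z^k) * (f * PowerSeries.X) := by
    intro f; ring
  rw [e, e']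
  rcases n with _ | _ | n
  · simp [qph, -map_pow]
  · simp [qph, qPhat, -map_pow, PowerSeries.coeff_succ_mul_X, PowerSeries.coeff_one]
  · simp only [map_sub, map_add, PowerSeries.coeff_C_mul, PowerSeries.coeff_succ_mul_X, PowerSeries.coeff_mk,
      PowerSeries.coeff_one, PowerSeries.coeff_X]
    have := qph_rec z n
    have e3 : PowerSeries.coeff (n+1) (1 : PowerSeries ℂ) = 0 := by simp [PowerSeries.coeff_one]
    simp [-map_pow, PowerSeries.coeff_C]
    linear_combination z^(k*(n+2)) * this

theorem qph_p (z : ℂ) (p : ℕ) (hodd : Odd p) (hz : IsPrimitiveRoot z p) : qph z p = 1 := by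
  have hp := hodd.pos
  have h := qp_iter _ _ _ (qp_H z) p
  have cu : ∀ i, (1 - PowerSeries.C (z^i) * PowerSeries.X : PowerSeries ℂ) =
    coeToPowerSeries.ringHom (1 - C (z^i) * X) := by intro i; simp
  have cv : ∀ i, (1 + PowerSeries.C (z^i) * PowerSeries.X : PowerSeries ℂ) =
    coeToPowerSeries.ringHom (1 + C (z^i) * X) := by intro i; simp
  have hv : ∀ m, ∏ i ∈ range m, (PowerSeries.C (z^i) * PowerSeries.X * (1 + PowerSeries.C (z^i) * PowerSeries.X))
      = PowerSeries.C (∏ i ∈ range m, z^i) * (PowerSeries.X ^ m * coeToPowerSeries.ringHom (∏ i ∈ range m, (1 + C (z^i) * X))) := by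
    intro m
    simp only [cv]
    rw [prod_mul_distrib, prod_mul_distrib, map_prod, map_prod]
    simp [mul_assoc]
  have hs : ∀ m ∈ range p, (∏ i ∈ range m, (PowerSeries.C (z^i) * PowerSeries.X * (1 + PowerSeries.C (z^i) * PowerSeries.X)))
      * (∏ i ∈ Ico m p, (1 - PowerSeries.C (z^i) * PowerSeries.X))
      = PowerSeries.C (∏ i ∈ range m, z^i) * (coeToPowerSeries.ringHom (qpB z p m) * PowerSeries.X ^ m) := by
    intro m hm
    rw [hv]
    simp only [cu]
    rw [← map_prod coeToPowerSeries.ringHom, qpB, prod_Ico_eq_prod_range, map_mul]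
    ring
  rw [sum_congr rfl hs, hv] at h
  simp only [cu] at h
  rw [← map_prod coeToPowerSeries.ringHom, qp_prod_sub z p hp hz, qp_prod_add z p hodd hz, qp_prodpow z p hodd hz.pow_eq_one] at h
  have h' := congrArg (PowerSeries.coeff p) h
  have t1 : ∀ f : PowerSeries ℂ, coeToPowerSeries.ringHom (1 - (X:ℂ[X])^p) * f = f - f * PowerSeries.X^p := by
    intro f; simp; ring
  have t2 : ∀ f : PowerSeries ℂ, PowerSeries.C (1:ℂ) * (PowerSeries.X ^ p * coeToPowerSeries.ringHom (1 + (X:ℂ[X])^p)) * f = (f + f * PowerSeries.X^p) * PowerSeries.X^p := by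
    intro f; simp; ring
  rw [t1, t2] at h'
  have hc : ∀ f : PowerSeries ℂ, ∀ m ≤ p, PowerSeries.coeff p (f * PowerSeries.X^m) = PowerSeries.coeff (p-m) f := by
    intro f m hm
    rw [PowerSeries.coeff_mul_X_pow', if_pos hm]
  have hB0 : (qpB z p 0).coeff p = -1 := by
    have := qp_prod_sub z p hp hz
    simp only [qpB, range_zero, prod_empty, one_mul, Nat.sub_zero, zero_add]
    rw [this]; simp [coeff_one, hp.ne']
  have hS : PowerSeries.coeff p (∑ m ∈ range p, PowerSeries.C (∏ i ∈ range m, z^i) * (coeToPowerSeries.ringHom (qpB z p m) * PowerSeries.X ^ m)) = -1 := by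
    rw [map_sum]
    have : ∀ m ∈ range p, PowerSeries.coeff p (PowerSeries.C (∏ i ∈ range m, z^i) * (coeToPowerSeries.ringHom (qpB z p m) * PowerSeries.X ^ m)) = (∏ i ∈ range m, z^i) * (qpB z p m).coeff (p-m) := by
      intro m hm
      rw [PowerSeries.coeff_C_mul, hc _ _ (mem_range.1 hm).le]
      simp
    rw [sum_congr rfl this, range_eq_Ico, sum_eq_sum_Ico_succ_bot hp]
    have := qp_sum z p hodd hz.pow_eq_one
    simp only [zero_add, Nat.sub_zero, hB0]
    rw [this]; simp
  rw [map_add, hS, map_sub, hc _ _ le_rfl, hc _ _ le_rfl] at h'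
  have h00 : qph z 0 = 1 := rfl
  simp [hp.ne', h00] at h'
  linear_combination h'

end aux

/-- For an odd prime p, P̂_{p+1}(q) − P̂_p(q) ≡ 1 (mod [p]_q) in ℤ[q]. -/
theorem qPellHat_succ_sub_congr (p : ℕ) (hp : p.Prime) (hodd : Odd p) :
    qbracket p ∣ qPhat (p + 1) - qPhat p - 1 := by
  haveI := Fact.mk hp
  have hz := Complex.isPrimitiveRoot_exp p hp.ne_zero
  set z := Complex.exp (2 * Real.pi * Complex.I / p)
  have h := qph_p z p hodd hz
  have hb : qbracket p = minpoly ℤ z := by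
    rw [← cyclotomic_eq_minpoly hz hp.pos, cyclotomic_prime, qbracket]
  rw [hb]
  apply minpoly.isIntegrallyClosed_dvd (hz.isIntegral hp.pos)
  obtain ⟨n, rfl⟩ : ∃ n, p = n + 1 := ⟨p-1, by have := hp.pos; omega⟩
  simp only [qph] at h
  have hz1 := hz.pow_eq_one
  simp [qPhat]
  rw [hz1]
  linear_combination h
end
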